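/- An algebra Γ is d-Auslander–Gorenstein if and only if for some (equivalently, every) m, n ≥ 0 with d = m + n − 1, there is a Γ-module in gen_{m-1}(Π) ∩ cogen^{n-1}(Π) that is simultaneously m-tilting and n-cotilting, where Π is the maximal projective-injective direct summand of Γ. -/

import Mathlib

/-!
Formalization of definitions from "Special tilting modules for algebras with positive
dominant dimension" (Pressland–Sauter), together with one of its statements.
-/

open CategoryTheory

noncomputable section
namespace PS

variable {R : Type} [Ring R]

/-- `N` is (isomorphic to) a direct summand of `M`. -/
def IsSummand (N M : ModuleCat.{0} R) : Prop :=
  ∃ (ι : N →ₗ[R] M) (π : M →ₗ[R] N), π ∘ₗ ι = LinearMap.id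

/-- `M` lies in `add X`: it is a direct summand of a finite direct sum of copies of `X`. -/
def MemAdd (X M : ModuleCat.{0} R) : Prop :=
  ∃ n : ℕ, IsSummand M (ModuleCat.of R (Fin n → X))

/-- `M` is projective-injective. -/
def ProjInj (M : ModuleCat.{0} R) : Prop :=
  Module.Projective R M ∧ Module.Injective R M

/-- The regular left module. -/
def reg (R : Type) [Ring R] : ModuleCat.{0} R := ModuleCat.of R R

/-- A module is basic if no nonzero module `X` has `X ⊕ X` as a direct summand of it
(equivalently, for finite length modules, its indecomposable direct summands are pairwise
non-isomorphic). -/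
def IsBasic (M : ModuleCat.{0} R) : Prop :=
  ∀ X : ModuleCat.{0} R, IsSummand (ModuleCat.of R (X × X)) M → Subsingleton X

/-- `P` is a maximal projective-injective direct summand of the regular module. -/
def IsMaxProjInjSummand (P : ModuleCat.{0} R) : Prop :=
  IsSummand P (reg R) ∧ ProjInj P ∧
    ∀ Q : ModuleCat.{0} R, IsSummand Q (reg R) → ProjInj Q → MemAdd P Q

/-- The data `Y 0 → Y 1 → ⋯ → Y n` forms an exact sequence
`0 → Y 0 → Y 1 → ⋯ → Y n → 0` (with `n ≥ 1` maps; terms beyond `Y n` are ignored). -/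
def IsExactSeq (n : ℕ) (Y : ℕ → ModuleCat.{0} R) (f : ∀ i, Y i →ₗ[R] Y (i+1)) : Prop :=
  Function.Injective (f 0) ∧ Function.Surjective (f (n-1)) ∧
    ∀ i, i + 2 ≤ n → Function.Exact (f i) (f (i+1))

/-- The algebra `R` has dominant dimension at least `k`: the regular module has an
injective resolution whose first `k` terms are projective-injective. -/
def DomdimGE (R : Type) [Ring R] (k : ℕ) : Prop :=
  ∃ (Y : ℕ → ModuleCat.{0} R) (g : reg R →ₗ[R] Y 0) (f : ∀ i, Y i →ₗ[R] Y (i+1)),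
    Function.Injective g ∧ Function.Exact g (f 0) ∧
    (∀ i, Function.Exact (f i) (f (i+1))) ∧
    (∀ i, Module.Injective R (Y i)) ∧ (∀ i, i < k → Module.Projective R (Y i))

/-- `domdim R = d`. -/
def DomdimEq (R : Type) [Ring R] (d : ℕ) : Prop :=
  DomdimGE R d ∧ ¬ DomdimGE R (d+1)

/-- The Ext group `Ext^j(M, N)` in the category of `R`-modules. -/
def ext (M N : ModuleCat.{0} R) (j : ℕ) : Type :=
  ((Ext ℤ (ModuleCat.{0} R) j).obj (Opposite.op M)).obj N

/-- `Ext^j(M, N) = 0` (for a single `j`). -/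
def ExtZero (M N : ModuleCat.{0} R) (j : ℕ) : Prop := Subsingleton (ext M N j)

/-- `Ext^j(M, N) = 0` for all `j ≥ 1`. -/
def ExtVanishing (M N : ModuleCat.{0} R) : Prop :=
  ∀ j : ℕ, 1 ≤ j → ExtZero M N j

/-- Projective dimension at most `k`. -/
def PdimLE (k : ℕ) (M : ModuleCat.{0} R) : Prop :=
  ∃ (Y : ℕ → ModuleCat.{0} R) (f : ∀ i, Y i →ₗ[R] Y (i+1)),
    IsExactSeq (k+1) Y f ∧ (∀ i, i ≤ k → Module.Projective R (Y i)) ∧ Y (k+1) = M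

/-- Injective dimension at most `k`. -/
def IdimLE (k : ℕ) (M : ModuleCat.{0} R) : Prop :=
  ∃ (Y : ℕ → ModuleCat.{0} R) (f : ∀ i, Y i →ₗ[R] Y (i+1)),
    IsExactSeq (k+1) Y f ∧ (∀ i, 1 ≤ i → i ≤ k+1 → Module.Injective R (Y i)) ∧ Y 0 = M

/-- `T` is a `k`-tilting module. -/
def IsTilting (k : ℕ) (T : ModuleCat.{0} R) : Prop :=
  Module.Finite R T ∧ PdimLE k T ∧ ExtVanishing T T ∧
    ∃ (Y : ℕ → ModuleCat.{0} R) (f : ∀ i, Y i →ₗ[R] Y (i+1)),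
      IsExactSeq (k+1) Y f ∧ Y 0 = reg R ∧ ∀ i, 1 ≤ i → i ≤ k+1 → MemAdd T (Y i)

/-- `T` is a `P`-special `k`-tilting module: it is `k`-tilting, and there is a coresolution
`0 → R → t_0 → ⋯ → t_k → 0` with all `t_j ∈ add T` and `t_j ∈ add P` for `j ≤ k-1`. -/
def IsSpecialTilting (P : ModuleCat.{0} R) (k : ℕ) (T : ModuleCat.{0} R) : Prop :=
  IsTilting k T ∧
    ∃ (Y : ℕ → ModuleCat.{0} R) (f : ∀ i, Y i →ₗ[R] Y (i+1)),
      IsExactSeq (k+1) Y f ∧ Y 0 = reg R ∧ (∀ i, 1 ≤ i → i ≤ k+1 → MemAdd T (Y i)) ∧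
        (∀ i, 1 ≤ i → i ≤ k → MemAdd P (Y i))

/-- `M ∈ gen_k(X)`: there is an exact sequence `X^k → ⋯ → X^0 → M → 0` with `X^i ∈ add X`. -/
def MemGen (k : ℕ) (X M : ModuleCat.{0} R) : Prop :=
  ∃ (Y : ℕ → ModuleCat.{0} R) (f : ∀ i, Y i →ₗ[R] Y (i+1)),
    (∀ i, i ≤ k → MemAdd X (Y i)) ∧ Y (k+1) = M ∧
    Function.Surjective (f k) ∧ ∀ i, i < k → Function.Exact (f i) (f (i+1))

/-- `M ∈ cogen^k(X)`: there is an exact sequence `0 → M → X_0 → ⋯ → X_k` with `X_i ∈ add X`. -/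
def MemCogen (k : ℕ) (X M : ModuleCat.{0} R) : Prop :=
  ∃ (Y : ℕ → ModuleCat.{0} R) (f : ∀ i, Y i →ₗ[R] Y (i+1)),
    (∀ i, 1 ≤ i → i ≤ k+1 → MemAdd X (Y i)) ∧ Y 0 = M ∧
    Function.Injective (f 0) ∧ ∀ i, i < k → Function.Exact (f i) (f (i+1))

/-- `M ∈ gen_{k-1}(X)`, where `gen_{-1}(X)` is the whole module category. -/
def MemGenShift : ℕ → ModuleCat.{0} R → ModuleCat.{0} R → Prop
  | 0, _X, _M => True
  | (k+1), X, M => MemGen k X M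

/-- `M ∈ cogen^{k-1}(X)`, where `cogen^{-1}(X)` is the whole module category. -/
def MemCogenShift : ℕ → ModuleCat.{0} R → ModuleCat.{0} R → Prop
  | 0, _X, _M => True
  | (k+1), X, M => MemCogen k X M

/-- Global dimension at most `n` (on finitely generated modules). -/
def GldimLE (R : Type) [Ring R] (n : ℕ) : Prop :=
  ∀ M : ModuleCat.{0} R, Module.Finite R M → PdimLE n M

/-- Global dimension exactly `n`. -/
def GldimEq (R : Type) [Ring R] (n : ℕ) : Prop :=
  GldimLE R n ∧ ∀ m : ℕ, GldimLE R m → n ≤ m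

section Duality

variable (K : Type) [Field K]

section DualDefs
variable (S M : Type) [Semiring S] [AddCommGroup M] [Module K M]

/-- The action of `s : S` as a `K`-linear endomorphism. -/
def actMap [Module S M] [SMulCommClass S K M] (s : S) : M →ₗ[K] M where
  toFun m := s • m
  map_add' := smul_add s
  map_smul' c m := (smul_comm s c m)

/-- The `K`-linear dual of a left `S`-module is a left `Sᵐᵒᵖ`-module (i.e. a right
`S`-module), by precomposition. -/
def dualModuleOp [Module S M] [SMulCommClass S K M] : Module Sᵐᵒᵖ (M →ₗ[K] K) where
  smul s φ := φ ∘ₗ actMap K S M s.unop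
  one_smul φ := by ext m; exact congrArg φ (one_smul S m)
  mul_smul s t φ := by ext m; exact congrArg φ (mul_smul t.unop s.unop m)
  smul_zero s := by ext m; rfl
  smul_add s φ ψ := by ext m; rfl
  add_smul s t φ := by
    ext m
    show φ ((s.unop + t.unop) • m) = φ (s.unop • m) + φ (t.unop • m)
    rw [add_smul, map_add]
  zero_smul φ := by
    ext m
    show φ ((0 : S) • m) = 0
    rw [zero_smul, map_zero]

/-- The `K`-linear dual of a right `S`-module is a left `S`-module, by precomposition. -/
def dualModuleUnop [Module Sᵐᵒᵖ M] [SMulCommClass Sᵐᵒᵖ K M] : Module S (M →ₗ[K] K) where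
  smul s φ := φ ∘ₗ actMap K Sᵐᵒᵖ M (MulOpposite.op s)
  one_smul φ := by ext m; exact congrArg φ (one_smul Sᵐᵒᵖ m)
  mul_smul s t φ := by
    ext m
    show φ (MulOpposite.op (s * t) • m) = φ (MulOpposite.op t • MulOpposite.op s • m)
    rw [← mul_smul]
    rfl
  smul_zero s := by ext m; rfl
  smul_add s φ ψ := by ext m; rfl
  add_smul s t φ := by
    ext m
    show φ ((MulOpposite.op s + MulOpposite.op t) • m)
      = φ (MulOpposite.op s • m) + φ (MulOpposite.op t • m)
    rw [add_smul, map_add]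
  zero_smul φ := by
    ext m
    show φ ((0 : Sᵐᵒᵖ) • m) = 0
    rw [zero_smul, map_zero]

end DualDefs

/-- `D R`: the `K`-linear dual of the right regular module, as a left `R`-module. -/
def Dreg (R : Type) [Ring R] [Algebra K R] : ModuleCat.{0} R :=
  letI : Module R (R →ₗ[K] K) := dualModuleUnop K R R
  ModuleCat.of R (R →ₗ[K] K)

variable {R : Type} [Ring R] [Algebra K R]

/-- The `K`-module structure on an `R`-module, via restriction of scalars. -/
def kMod (M : ModuleCat.{0} R) : Module K M := Module.compHom M (algebraMap K R)

theorem kMod_smulCommClass (M : ModuleCat.{0} R) :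
    letI := kMod K M; SMulCommClass R K M := by
  letI := kMod K M
  constructor
  intro r c m
  show r • (algebraMap K R c • m) = algebraMap K R c • (r • m)
  rw [← mul_smul, ← mul_smul, Algebra.commutes]

theorem kMod_end_smulCommClass (M : ModuleCat.{0} R) :
    letI := kMod K M; SMulCommClass (Module.End R M) K M := by
  letI := kMod K M
  constructor
  intro f c m
  show f (algebraMap K R c • m) = algebraMap K R c • f m
  rw [map_smul]

/-- The dual `D T` of a left `R`-module `T`, as a left module over `B = End_R(T)ᵒᵖ`. -/
def DT (T : ModuleCat.{0} R) : ModuleCat.{0} ((Module.End R T)ᵐᵒᵖ) :=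
  letI := kMod K T
  letI := kMod_end_smulCommClass K T
  letI : Module (Module.End R T)ᵐᵒᵖ (T →ₗ[K] K) := dualModuleOp K (Module.End R T) T
  ModuleCat.of _ (T →ₗ[K] K)

/-- `C` is a `k`-cotilting module. -/
def IsCotilting (k : ℕ) (C : ModuleCat.{0} R) : Prop :=
  Module.Finite R C ∧ IdimLE k C ∧ ExtVanishing C C ∧
    ∃ (Y : ℕ → ModuleCat.{0} R) (f : ∀ i, Y i →ₗ[R] Y (i+1)),
      IsExactSeq (k+1) Y f ∧ Y (k+1) = Dreg K R ∧ ∀ i, i ≤ k → MemAdd C (Y i)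

/-- `C` is an `I`-special `k`-cotilting module: it is `k`-cotilting, and there is a resolution
`0 → c^k → ⋯ → c^0 → D R → 0` with all `c^j ∈ add C` and `c^j ∈ add I` for `j ≤ k-1`. -/
def IsSpecialCotilting (I : ModuleCat.{0} R) (k : ℕ) (C : ModuleCat.{0} R) : Prop :=
  IsCotilting K k C ∧
    ∃ (Y : ℕ → ModuleCat.{0} R) (f : ∀ i, Y i →ₗ[R] Y (i+1)),
      IsExactSeq (k+1) Y f ∧ Y (k+1) = Dreg K R ∧ (∀ i, i ≤ k → MemAdd C (Y i)) ∧
        (∀ i, 1 ≤ i → i ≤ k → MemAdd I (Y i))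

/-- `R` is a `d`-Auslander–Gorenstein algebra: `id R ≤ d+1 ≤ domdim R`. -/
def IsAuslanderGorenstein (R : Type) [Ring R] (d : ℕ) : Prop :=
  IdimLE (d+1) (reg R) ∧ DomdimGE R (d+1)

/-- `R` is a `d`-Auslander algebra: `gldim R ≤ d+1 ≤ domdim R`. -/
def IsAuslander (R : Type) [Ring R] (d : ℕ) : Prop :=
  GldimLE R (d+1) ∧ DomdimGE R (d+1)

end Duality

end PS
end

namespace PS
variable {R : Type} [Ring R]

/-- For `j ≥ 1`, vanishing of the derived-functor `Ext` is vanishing of the abelian `Ext`. -/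
theorem extZero_succ_iff (M N : ModuleCat.{0} R) (j : ℕ) :
    ExtZero M N (j + 1) ↔ Subsingleton (Abelian.Ext M N (j + 1)) := by
  let P := projectiveResolution M
  have h1 : Subsingleton (Abelian.Ext M N (j + 1)) ↔
      ∀ f : P.complex.X (j + 1) ⟶ N, P.complex.d (j + 2) (j + 1) ≫ f = 0 →
        ∃ g : P.complex.X j ⟶ N, P.complex.d (j + 1) j ≫ g = f := by
    constructor
    · intro hs f hf
      exact (P.extMk_eq_zero_iff f (j + 2) rfl hf j rfl).1 (Subsingleton.elim _ _)
    · intro h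
      refine subsingleton_of_forall_eq 0 fun α => ?_
      obtain ⟨f, hf, rfl⟩ := P.extMk_surjective α (j + 2) rfl
      exact (P.extMk_eq_zero_iff f (j + 2) rfl hf j rfl).2 (h f hf)
  have h2 : ExtZero M N (j + 1) ↔
      (P.complex.linearYonedaObj ℤ N).ExactAt (j + 1) := by
    rw [HomologicalComplex.exactAt_iff_isZero_homology]
    rw [← (P.isoExt (R := ℤ) (j + 1) N).isZero_iff, ModuleCat.isZero_iff_subsingleton]
    rfl
  rw [h1, h2, HomologicalComplex.exactAt_iff' _ j (j + 1) (j + 2) (by simp) (by simp),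
    ShortComplex.moduleCat_exact_iff]
  constructor
  · intro h f hf
    obtain ⟨g, hg⟩ := h f hf
    exact ⟨g, hg⟩
  · intro h f hf
    obtain ⟨g, hg⟩ := h f hf
    exact ⟨g, hg⟩

/-- `Ext^j(X, N) = 0` for all `j ≥ 1`, in terms of the abelian `Ext`. -/
def LeftPerp (N X : ModuleCat.{0} R) : Prop :=
  ∀ j : ℕ, Subsingleton (Abelian.Ext X N (j + 1))

theorem extVanishing_iff_leftPerp (M N : ModuleCat.{0} R) :
    ExtVanishing M N ↔ LeftPerp N M := by
  constructor
  · intro h j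
    exact (extZero_succ_iff M N j).1 (h (j + 1) (by omega))
  · intro h j hj
    obtain ⟨j, rfl⟩ : ∃ i, j = i + 1 := ⟨j - 1, by omega⟩
    exact (extZero_succ_iff M N j).2 (h j)

theorem leftPerp_of_projective (N : ModuleCat.{0} R) {X : ModuleCat.{0} R}
    (hX : Module.Projective R X) : LeftPerp N X := by
  intro j
  have : Projective X := (IsProjective.iff_projective X).1 hX
  exact subsingleton_of_forall_eq 0 fun e => e.eq_zero_of_projective

theorem leftPerp_of_isSummand {N X Y : ModuleCat.{0} R} (h : IsSummand X Y)
    (hY : LeftPerp N Y) : LeftPerp N X := by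
  obtain ⟨ι, π, hπ⟩ := h
  intro j
  refine subsingleton_of_forall_eq 0 fun e => ?_
  have hid : ModuleCat.ofHom ι ≫ ModuleCat.ofHom π = 𝟙 X := by
    rw [← ModuleCat.ofHom_comp, hπ]; rfl
  have := hY j
  rw [← Abelian.Ext.mk₀_id_comp e, ← hid, ← Abelian.Ext.mk₀_comp_mk₀,
    Abelian.Ext.comp_assoc_of_second_deg_zero,
    Subsingleton.elim ((Abelian.Ext.mk₀ (ModuleCat.ofHom π)).comp e (zero_add (j + 1))) 0,
    Abelian.Ext.comp_zero]

section ShortExact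

variable {X Y C : ModuleCat.{0} R} {i : X →ₗ[R] Y} {p : Y →ₗ[R] C}

theorem exists_shortExact (hi : Function.Injective i) (hip : Function.Exact i p)
    (hp : Function.Surjective p) :
    ∃ h : ModuleCat.ofHom i ≫ ModuleCat.ofHom p = 0,
      (ShortComplex.mk (ModuleCat.ofHom i) (ModuleCat.ofHom p) h).ShortExact := by
  have h : ModuleCat.ofHom i ≫ ModuleCat.ofHom p = 0 := by
    ext x
    exact hip.apply_apply_eq_zero x
  refine ⟨h, ?_⟩
  have hm : Mono (ModuleCat.ofHom i) := (ModuleCat.mono_iff_injective _).2 hi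
  have he : Epi (ModuleCat.ofHom p) := (ModuleCat.epi_iff_surjective _).2 hp
  exact { exact := (ShortComplex.ShortExact.moduleCat_exact_iff_function_exact _).2 hip
          mono_f := hm, epi_g := he }

theorem leftPerp_left {N : ModuleCat.{0} R} (hi : Function.Injective i)
    (hip : Function.Exact i p) (hp : Function.Surjective p) (hY : LeftPerp N Y)
    (hC : LeftPerp N C) : LeftPerp N X := by
  obtain ⟨w, hS⟩ := exists_shortExact hi hip hp
  intro j
  refine subsingleton_of_forall_eq 0 fun e => ?_
  have := hC (j + 1)
  have := hY j
  obtain ⟨y, rfl⟩ := Abelian.Ext.contravariant_sequence_exact₁ hS N e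
    (n₁ := j + 2) (by omega) (Subsingleton.elim (α := Abelian.Ext C N (j + 2)) _ _)
  rw [Subsingleton.elim (α := Abelian.Ext Y N (j + 1)) y 0, Abelian.Ext.comp_zero]

theorem leftPerp_middle {N : ModuleCat.{0} R} (hi : Function.Injective i)
    (hip : Function.Exact i p) (hp : Function.Surjective p) (hX : LeftPerp N X)
    (hC : LeftPerp N C) : LeftPerp N Y := by
  obtain ⟨w, hS⟩ := exists_shortExact hi hip hp
  intro j
  refine subsingleton_of_forall_eq 0 fun e => ?_
  have := hX j
  have := hC j
  obtain ⟨y, rfl⟩ := Abelian.Ext.contravariant_sequence_exact₂ hS N e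
    (Subsingleton.elim (α := Abelian.Ext X N (j + 1)) _ _)
  rw [Subsingleton.elim (α := Abelian.Ext C N (j + 1)) y 0, Abelian.Ext.comp_zero]

theorem leftPerp_right {N : ModuleCat.{0} R} (hi : Function.Injective i)
    (hip : Function.Exact i p) (hp : Function.Surjective p) (hX : LeftPerp N X)
    (hY : LeftPerp N Y) (hext : ∀ g : X →ₗ[R] N, ∃ h : Y →ₗ[R] N, h ∘ₗ i = g) :
    LeftPerp N C := by
  obtain ⟨w, hS⟩ := exists_shortExact hi hip hp
  intro j
  refine subsingleton_of_forall_eq 0 fun e => ?_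
  have := hY j
  obtain ⟨y, rfl⟩ := Abelian.Ext.contravariant_sequence_exact₃ hS N e
    (Subsingleton.elim (α := Abelian.Ext Y N (j + 1)) _ _) (n₀ := j) (by omega)
  cases j with
  | succ j =>
    have := hX j
    rw [Subsingleton.elim (α := Abelian.Ext X N (j + 1)) y 0, Abelian.Ext.comp_zero]
  | zero =>
    obtain ⟨g, rfl⟩ := (Abelian.Ext.mk₀_bijective X N).2 y
    obtain ⟨h, hh⟩ := hext g.hom
    have hg : g = ModuleCat.ofHom i ≫ ModuleCat.ofHom h := by
      rw [← ModuleCat.ofHom_comp, hh]; rfl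
    rw [hg, ← Abelian.Ext.mk₀_comp_mk₀]
    exact hS.extClass_comp_assoc _

theorem exists_extension_of_leftPerp {N : ModuleCat.{0} R} (hi : Function.Injective i)
    (hip : Function.Exact i p) (hp : Function.Surjective p) (hC : LeftPerp N C)
    (g : X →ₗ[R] N) : ∃ h : Y →ₗ[R] N, h ∘ₗ i = g := by
  obtain ⟨w, hS⟩ := exists_shortExact hi hip hp
  have := hC 0
  obtain ⟨y, hy⟩ := Abelian.Ext.contravariant_sequence_exact₁ hS N
    (Abelian.Ext.mk₀ (ModuleCat.ofHom g)) (n₁ := 1) rfl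
    (Subsingleton.elim (α := Abelian.Ext C N 1) _ _)
  obtain ⟨h, rfl⟩ := (Abelian.Ext.mk₀_bijective Y N).2 y
  rw [Abelian.Ext.mk₀_comp_mk₀] at hy
  have := (Abelian.Ext.mk₀_bijective X N).1 hy
  exact ⟨h.hom, by simpa using congrArg ModuleCat.Hom.hom this⟩

end ShortExact
end PS

namespace PS
variable {R : Type} [Ring R]

section LinearMaps

variable {M N P X : Type} [AddCommGroup M] [Module R M] [AddCommGroup N] [Module R N]
  [AddCommGroup P] [Module R P] [AddCommGroup X] [Module R X]

theorem exists_desc_of_exact {i : M →ₗ[R] N} {p : N →ₗ[R] P} (hip : Function.Exact i p)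
    (hp : Function.Surjective p) (g : N →ₗ[R] X) (hg : g ∘ₗ i = 0) :
    ∃ h : P →ₗ[R] X, h ∘ₗ p = g := by
  have hk : LinearMap.ker p ≤ LinearMap.ker g := by
    intro x hx
    obtain ⟨y, rfl⟩ := (hip x).1 hx
    exact LinearMap.congr_fun hg y
  refine ⟨(LinearMap.ker p).liftQ g hk ∘ₗ (p.quotKerEquivOfSurjective hp).symm, ?_⟩
  ext x
  have : (p.quotKerEquivOfSurjective hp).symm (p x) = Submodule.Quotient.mk x := by
    rw [LinearEquiv.symm_apply_eq]
    rfl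
  simp [this]

theorem exists_lift_of_exact {i : M →ₗ[R] N} {p : N →ₗ[R] P} (hi : Function.Injective i)
    (hip : Function.Exact i p) (g : X →ₗ[R] N) (hg : p ∘ₗ g = 0) :
    ∃ h : X →ₗ[R] M, i ∘ₗ h = g := by
  have hr : ∀ x, g x ∈ LinearMap.range i := fun x => (hip _).1 (LinearMap.congr_fun hg x)
  refine ⟨(LinearEquiv.ofInjective i hi).symm ∘ₗ g.codRestrict _ hr, ?_⟩
  ext x
  have := (LinearEquiv.ofInjective i hi).apply_symm_apply (g.codRestrict _ hr x)
  exact congrArg Subtype.val this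

theorem exists_extension_of_injective (hX : Module.Injective R X) {i : M →ₗ[R] N}
    (hi : Function.Injective i) (g : M →ₗ[R] X) : ∃ h : N →ₗ[R] X, h ∘ₗ i = g := by
  obtain ⟨h, hh⟩ := hX.out i hi g
  exact ⟨h, LinearMap.ext hh⟩

theorem comp_eq_comp_of_surjective {p : M →ₗ[R] N} (hp : Function.Surjective p)
    {f g : N →ₗ[R] P} (h : f ∘ₗ p = g ∘ₗ p) : f = g :=
  (LinearMap.cancel_right hp).1 h

theorem injective_of_retract (hX : Module.Injective R X) (i : M →ₗ[R] X) (p : X →ₗ[R] M)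
    (h : p ∘ₗ i = LinearMap.id) : Module.Injective R M := by
  refine ⟨fun A B _ _ _ _ f hf g => ?_⟩
  obtain ⟨k, hk⟩ := hX.out f hf (i ∘ₗ g)
  refine ⟨p ∘ₗ k, fun x => ?_⟩
  simpa [hk] using LinearMap.congr_fun h (g x)

theorem injective_prod (hM : Module.Injective R M) (hN : Module.Injective R N) :
    Module.Injective R (M × N) := by
  refine ⟨fun A B _ _ _ _ f hf g => ?_⟩
  obtain ⟨k, hk⟩ := hM.out f hf (LinearMap.fst R M N ∘ₗ g)
  obtain ⟨l, hl⟩ := hN.out f hf (LinearMap.snd R M N ∘ₗ g)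
  exact ⟨k.prod l, fun x => Prod.ext (hk x) (hl x)⟩

end LinearMaps

theorem IsSummand.refl (M : ModuleCat.{0} R) : IsSummand M M :=
  ⟨LinearMap.id, LinearMap.id, rfl⟩

theorem IsSummand.trans {L M N : ModuleCat.{0} R} (h : IsSummand L M) (h' : IsSummand M N) :
    IsSummand L N := by
  obtain ⟨i, p, hp⟩ := h
  obtain ⟨j, q, hq⟩ := h'
  refine ⟨j ∘ₗ i, p ∘ₗ q, ?_⟩
  rw [LinearMap.comp_assoc, ← LinearMap.comp_assoc i, hq, LinearMap.id_comp, hp]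

theorem isSummand_of_equiv {M N : ModuleCat.{0} R} (e : M ≃ₗ[R] N) : IsSummand M N :=
  ⟨e, e.symm, by ext; simp⟩

theorem isSummand_prod_left (M N : ModuleCat.{0} R) : IsSummand M (ModuleCat.of R (M × N)) :=
  ⟨LinearMap.inl R M N, LinearMap.fst R M N, LinearMap.fst_comp_inl R M N⟩

theorem isSummand_prod_right (M N : ModuleCat.{0} R) : IsSummand N (ModuleCat.of R (M × N)) :=
  ⟨LinearMap.inr R M N, LinearMap.snd R M N, LinearMap.snd_comp_inr R M N⟩

/-- A class of modules closed under direct summands. -/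
def SummandClosed (Z : ModuleCat.{0} R → Prop) : Prop :=
  ∀ ⦃M N⦄, IsSummand M N → Z N → Z M

/-- A class of modules closed under binary products. -/
def ProdClosed (Z : ModuleCat.{0} R → Prop) : Prop :=
  ∀ ⦃M N⦄, Z M → Z N → Z (ModuleCat.of R (M × N))

theorem memAdd_iff_sum {X M : ModuleCat.{0} R} : MemAdd X M ↔
    ∃ (ι : Type) (_ : Fintype ι) (a : ι → M →ₗ[R] X) (b : ι → X →ₗ[R] M),
      ∑ k, b k ∘ₗ a k = LinearMap.id := by
  classical
  constructor
  · rintro ⟨n, i, p, h⟩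
    refine ⟨Fin n, inferInstance, fun k => LinearMap.proj k ∘ₗ i,
      fun k => p ∘ₗ LinearMap.single R (fun _ => (X : Type)) k, ?_⟩
    rw [← h]
    ext x
    simp only [LinearMap.sum_apply, LinearMap.comp_apply, ← map_sum]
    congr 1
    exact LinearMap.sum_single_apply (fun _ : Fin n => (X : Type)) (i x)
  · rintro ⟨ι, _, a, b, h⟩
    let e := Fintype.equivFin ι
    refine ⟨Fintype.card ι, LinearMap.pi fun t => a (e.symm t),
      ∑ t, b (e.symm t) ∘ₗ LinearMap.proj t, ?_⟩
    rw [← h]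
    ext x
    simp only [LinearMap.sum_apply, LinearMap.comp_apply]
    exact e.symm.sum_comp (fun k => b k (a k x))

theorem memAdd_of_sum {X M : ModuleCat.{0} R} {ι : Type} [Fintype ι]
    (N : ι → ModuleCat.{0} R) (hN : ∀ k, MemAdd X (N k)) (a : ∀ k, M →ₗ[R] N k)
    (b : ∀ k, N k →ₗ[R] M) (h : ∑ k, b k ∘ₗ a k = LinearMap.id) : MemAdd X M := by
  simp only [memAdd_iff_sum] at hN
  choose κ hκ a' b' h' using hN
  refine memAdd_iff_sum.2 ⟨Σ k, κ k, inferInstance, fun t => a' t.1 t.2 ∘ₗ a t.1,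
    fun t => b t.1 ∘ₗ b' t.1 t.2, ?_⟩
  rw [← h, Fintype.sum_sigma]
  refine Finset.sum_congr rfl fun k _ => ?_
  ext x
  have := LinearMap.congr_fun (h' k) (a k x)
  simp only [LinearMap.sum_apply, LinearMap.comp_apply, LinearMap.id_apply] at this ⊢
  exact (map_sum (b k) _ _).symm.trans (congrArg (b k) this)

theorem memAdd_self (X : ModuleCat.{0} R) : MemAdd X X :=
  memAdd_iff_sum.2 ⟨Unit, inferInstance, fun _ => LinearMap.id, fun _ => LinearMap.id, by simp⟩

theorem summandClosed_memAdd (X : ModuleCat.{0} R) : SummandClosed (MemAdd X) := by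
  rintro M N ⟨i, p, h⟩ ⟨n, hn⟩
  exact ⟨n, IsSummand.trans ⟨i, p, h⟩ hn⟩

theorem prodClosed_memAdd (X : ModuleCat.{0} R) : ProdClosed (MemAdd X) := by
  intro M N hM hN
  refine memAdd_of_sum (ι := Bool) (fun t => if t then M else N) (by simp [hM, hN])
    (fun t => match t with
      | true => LinearMap.fst R M N
      | false => LinearMap.snd R M N)
    (fun t => match t with
      | true => LinearMap.inl R M N
      | false => LinearMap.inr R M N) ?_
  ext x <;> simp

theorem MemAdd.trans {X Y M : ModuleCat.{0} R} (h : MemAdd Y M) (hY : MemAdd X Y) :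
    MemAdd X M := by
  obtain ⟨ι, _, a, b, hab⟩ := memAdd_iff_sum.1 h
  exact memAdd_of_sum (fun _ => Y) (fun _ => hY) a b hab

theorem IsSummand.memAdd {X M : ModuleCat.{0} R} (h : IsSummand M X) : MemAdd X M :=
  summandClosed_memAdd X h (memAdd_self X)

/-- A class closed under summands and products contains `add X` as soon as it contains `X`. -/
theorem of_memAdd {Z : ModuleCat.{0} R → Prop} (hs : SummandClosed Z) (hp : ProdClosed Z)
    {X M : ModuleCat.{0} R} (hX : Z X) (hM : MemAdd X M) : Z M := by
  obtain ⟨n, hn⟩ := hM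
  refine hs hn ?_
  clear hn M
  induction n with
  | zero => exact hs ⟨0, 0, LinearMap.ext fun x => funext fun i => i.elim0⟩ hX
  | succ n ih =>
    refine hs (isSummand_of_equiv ?_) (hp hX ih)
    exact (Fin.consLinearEquiv R (fun _ : Fin (n + 1) => (X : Type))).symm

theorem summandClosed_injective :
    SummandClosed fun M : ModuleCat.{0} R => Module.Injective R M := by
  rintro M N ⟨i, p, h⟩ hN
  exact injective_of_retract hN i p h

theorem prodClosed_injective :
    ProdClosed fun M : ModuleCat.{0} R => Module.Injective R M :=
  fun _ _ => injective_prod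

theorem summandClosed_projective :
    SummandClosed fun M : ModuleCat.{0} R => Module.Projective R M := by
  rintro M N ⟨i, p, h⟩ hN
  exact Module.Projective.of_split i p h

theorem prodClosed_projective :
    ProdClosed fun M : ModuleCat.{0} R => Module.Projective R M := by
  intro M N (hM : Module.Projective R M) (hN : Module.Projective R N)
  exact (inferInstance : Module.Projective R (M × N))

theorem summandClosed_projInj : SummandClosed (ProjInj (R := R)) :=
  fun _ _ h hN => ⟨summandClosed_projective h hN.1, summandClosed_injective h hN.2⟩

theorem prodClosed_projInj : ProdClosed (ProjInj (R := R)) :=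
  fun _ _ hM hN => ⟨prodClosed_projective hM.1 hN.1, prodClosed_injective hM.2 hN.2⟩

theorem summandClosed_finite :
    SummandClosed fun M : ModuleCat.{0} R => Module.Finite R M := by
  rintro M N ⟨i, p, h⟩ (hN : Module.Finite R N)
  exact Module.Finite.of_surjective p fun x => ⟨i x, LinearMap.congr_fun h x⟩

theorem prodClosed_finite :
    ProdClosed fun M : ModuleCat.{0} R => Module.Finite R M := by
  intro M N (hM : Module.Finite R M) (hN : Module.Finite R N)
  exact (inferInstance : Module.Finite R (M × N))

theorem ProjInj.of_memAdd {X M : ModuleCat.{0} R} (hX : ProjInj X) (hM : MemAdd X M) :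
    ProjInj M :=
  PS.of_memAdd summandClosed_projInj prodClosed_projInj hX hM

theorem summandClosed_leftPerp (N : ModuleCat.{0} R) : SummandClosed (LeftPerp N) :=
  fun _ _ => leftPerp_of_isSummand

theorem prodClosed_leftPerp (N : ModuleCat.{0} R) : ProdClosed (LeftPerp N) :=
  fun A B hA hB => leftPerp_middle (X := A) (Y := ModuleCat.of R (A × B)) (C := B)
    (i := LinearMap.inl R A B) (p := LinearMap.snd R A B)
    LinearMap.inl_injective .inl_snd LinearMap.snd_surjective hA hB

end PS

namespace PS
variable {R : Type} [Ring R]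

/-- `0 → M → N → P → 0` is a short exact sequence. -/
structure IsSES {M N P : Type} [AddCommGroup M] [Module R M] [AddCommGroup N] [Module R N]
    [AddCommGroup P] [Module R P] (i : M →ₗ[R] N) (p : N →ₗ[R] P) : Prop where
  inj : Function.Injective i
  exact : Function.Exact i p
  surj : Function.Surjective p

section ShortExact

variable {M N P M' N' P' : Type} [AddCommGroup M] [Module R M] [AddCommGroup N] [Module R N]
  [AddCommGroup P] [Module R P] [AddCommGroup M'] [Module R M'] [AddCommGroup N'] [Module R N']
  [AddCommGroup P'] [Module R P']

theorem isSES_mkQ {i : M →ₗ[R] N} (hi : Function.Injective i) :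
    IsSES i (LinearMap.range i).mkQ :=
  ⟨hi, LinearMap.exact_map_mkQ_range i, Submodule.mkQ_surjective _⟩

theorem isSES_ker {p : N →ₗ[R] P} (hp : Function.Surjective p) :
    IsSES (LinearMap.ker p).subtype p :=
  ⟨Subtype.val_injective, LinearMap.exact_subtype_ker_map p, hp⟩

theorem IsSES.comp_eq_zero {i : M →ₗ[R] N} {p : N →ₗ[R] P} (h : IsSES i p) : p ∘ₗ i = 0 :=
  h.exact.linearMap_comp_eq_zero

theorem IsSES.prodMap {i : M →ₗ[R] N} {p : N →ₗ[R] P} (h : IsSES i p) {i' : M' →ₗ[R] N'}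
    {p' : N' →ₗ[R] P'} (h' : IsSES i' p') : IsSES (i.prodMap i') (p.prodMap p') where
  inj := by
    rw [LinearMap.coe_prodMap]
    exact Function.Injective.prodMap h.inj h'.inj
  exact := by
    rintro ⟨x, y⟩
    simp [Prod.ext_iff, h.exact x, h'.exact y]
  surj := by
    rw [LinearMap.coe_prodMap]
    exact Function.Surjective.prodMap h.surj h'.surj

theorem isSES_diag : IsSES (LinearMap.inl R M N) (LinearMap.snd R M N) :=
  ⟨LinearMap.inl_injective, .inl_snd, LinearMap.snd_surjective⟩

/-- Schanuel lemma for cokernels, relative to a retract. -/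
theorem retract_coker {i : M →ₗ[R] N} {p : N →ₗ[R] P} (h : IsSES i p) {i' : M' →ₗ[R] N'}
    {p' : N' →ₗ[R] P'} (h' : IsSES i' p') {ι : M →ₗ[R] M'} {π : M' →ₗ[R] M}
    (hπ : π ∘ₗ ι = LinearMap.id) {a : N →ₗ[R] N'} (ha : a ∘ₗ i = i' ∘ₗ ι) {b : N' →ₗ[R] N}
    (hb : b ∘ₗ i' = i ∘ₗ π) :
    ∃ (j : P →ₗ[R] P' × N) (q : P' × N →ₗ[R] P), q ∘ₗ j = LinearMap.id := by
  have ha' : ∀ x, a (i x) = i' (ι x) := LinearMap.congr_fun ha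
  have hb' : ∀ x, b (i' x) = i (π x) := LinearMap.congr_fun hb
  have hπ' : ∀ x, π (ι x) = x := LinearMap.congr_fun hπ
  obtain ⟨s, hs⟩ := exists_desc_of_exact h.exact h.surj (LinearMap.id - b ∘ₗ a)
    (by ext x; simp [ha', hb', hπ'])
  obtain ⟨a₁, ha₁⟩ := exists_desc_of_exact h.exact h.surj (p' ∘ₗ a)
    (by ext x; simp [ha', h'.exact.apply_apply_eq_zero])
  obtain ⟨b₁, hb₁⟩ := exists_desc_of_exact h'.exact h'.surj (p ∘ₗ b)
    (by ext x; simp [hb', h.exact.apply_apply_eq_zero])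
  refine ⟨a₁.prod s, b₁.coprod p, comp_eq_comp_of_surjective h.surj ?_⟩
  ext x
  have e₁ : s (p x) = x - b (a x) := LinearMap.congr_fun hs x
  have e₂ : a₁ (p x) = p' (a x) := LinearMap.congr_fun ha₁ x
  have e₃ : b₁ (p' (a x)) = p (b (a x)) := LinearMap.congr_fun hb₁ (a x)
  simp [e₁, e₂, e₃]

/-- Schanuel lemma for kernels, relative to a retract. -/
theorem retract_ker {i : M →ₗ[R] N} {p : N →ₗ[R] P} (h : IsSES i p) {i' : M' →ₗ[R] N'}
    {p' : N' →ₗ[R] P'} (h' : IsSES i' p') {ι : P →ₗ[R] P'} {π : P' →ₗ[R] P}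
    (hπ : π ∘ₗ ι = LinearMap.id) {a : N →ₗ[R] N'} (ha : p' ∘ₗ a = ι ∘ₗ p) {b : N' →ₗ[R] N}
    (hb : p ∘ₗ b = π ∘ₗ p') :
    ∃ (j : M →ₗ[R] M' × N) (q : M' × N →ₗ[R] M), q ∘ₗ j = LinearMap.id := by
  have ha' : ∀ x, p' (a x) = ι (p x) := LinearMap.congr_fun ha
  have hb' : ∀ x, p (b x) = π (p' x) := LinearMap.congr_fun hb
  have hπ' : ∀ x, π (ι x) = x := LinearMap.congr_fun hπ
  obtain ⟨s, hs⟩ := exists_lift_of_exact h.inj h.exact (LinearMap.id - b ∘ₗ a)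
    (by ext x; simp [ha', hb', hπ'])
  obtain ⟨a₁, ha₁⟩ := exists_lift_of_exact h'.inj h'.exact (a ∘ₗ i)
    (by ext x; simp [ha', h.exact.apply_apply_eq_zero])
  obtain ⟨b₁, hb₁⟩ := exists_lift_of_exact h.inj h.exact (b ∘ₗ i')
    (by ext x; simp [hb', h'.exact.apply_apply_eq_zero])
  refine ⟨a₁.prod i, b₁.coprod s, (LinearMap.cancel_left h.inj).1 ?_⟩
  ext x
  have e₁ : i (s (i x)) = i x - b (a (i x)) := LinearMap.congr_fun hs (i x)
  have e₂ : i' (a₁ x) = a (i x) := LinearMap.congr_fun ha₁ x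
  have e₃ : i (b₁ (a₁ x)) = b (i' (a₁ x)) := LinearMap.congr_fun hb₁ (a₁ x)
  simp [e₁, e₂, e₃]

end ShortExact

/-- `M` has a coresolution `0 → M → I₁ → ⋯ → I_k → C → 0` with `Q I_j` and `Z C`, such that
each step is a left approximation with respect to the modules satisfying `A`. -/
def Cog (A Q Z : ModuleCat.{0} R → Prop) : ℕ → ModuleCat.{0} R → Prop
  | 0, M => Z M
  | k + 1, M => ∃ (I C : ModuleCat.{0} R) (i : M →ₗ[R] I) (p : I →ₗ[R] C), IsSES i p ∧ Q I ∧
      (∀ J : ModuleCat.{0} R, A J → ∀ g : M →ₗ[R] J, ∃ h : I →ₗ[R] J, h ∘ₗ i = g) ∧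
      Cog A Q Z k C

/-- `M` has a resolution `0 → K → P_k → ⋯ → P₁ → M → 0` with `Q P_j` and `Z K`. -/
def Gen (Q Z : ModuleCat.{0} R → Prop) : ℕ → ModuleCat.{0} R → Prop
  | 0, M => Z M
  | k + 1, M => ∃ (K P : ModuleCat.{0} R) (i : K →ₗ[R] P) (p : P →ₗ[R] M), IsSES i p ∧ Q P ∧
      Gen Q Z k K

/-- The empty class of modules. -/
abbrev noMod : ModuleCat.{0} R → Prop := fun _ => False

/-- The class of all modules. -/
abbrev allMod : ModuleCat.{0} R → Prop := fun _ => True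

variable {A A' Q Q' Z Z' W : ModuleCat.{0} R → Prop}

theorem Cog.mono (hA : ∀ M, A' M → A M) (hQ : ∀ M, Q M → Q' M) (hZ : ∀ M, Z M → Z' M) :
    ∀ {k : ℕ} {M : ModuleCat.{0} R}, Cog A Q Z k M → Cog A' Q' Z' k M
  | 0, _, h => hZ _ h
  | _ + 1, _, ⟨I, C, i, p, h, hI, happ, hC⟩ =>
    ⟨I, C, i, p, h, hQ I hI, fun J hJ => happ J (hA J hJ), hC.mono hA hQ hZ⟩

theorem Cog.weaken {k : ℕ} {M : ModuleCat.{0} R} (h : Cog A Q Z k M) : Cog noMod Q Z k M :=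
  h.mono (fun _ h => h.elim) (fun _ h => h) (fun _ h => h)

theorem Cog.approx_of_injective (hA : ∀ M, A M → Module.Injective R M) :
    ∀ {k : ℕ} {M : ModuleCat.{0} R}, Cog noMod Q Z k M → Cog A Q Z k M
  | 0, _, h => h
  | _ + 1, _, ⟨I, C, i, p, h, hI, _, hC⟩ =>
    ⟨I, C, i, p, h, hI, fun J hJ => exists_extension_of_injective (hA J hJ) h.inj,
      hC.approx_of_injective hA⟩

theorem cog_append : ∀ {m n : ℕ} {M : ModuleCat.{0} R}, Cog A Q (Cog A Q Z n) m M →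
    Cog A Q Z (m + n) M
  | 0, n, _, h => by rwa [Nat.zero_add]
  | m + 1, n, _, ⟨I, C, i, p, h, hI, happ, hC⟩ => by
    rw [Nat.add_right_comm]
    exact ⟨I, C, i, p, h, hI, happ, cog_append hC⟩

theorem cog_split : ∀ {m n : ℕ} {M : ModuleCat.{0} R}, Cog A Q Z (m + n) M →
    Cog A Q (Cog A Q Z n) m M
  | 0, n, _, h => by rwa [Nat.zero_add] at h
  | m + 1, n, _, h => by
    rw [Nat.add_right_comm] at h
    obtain ⟨I, C, i, p, h, hI, happ, hC⟩ := h
    exact ⟨I, C, i, p, h, hI, happ, cog_split hC⟩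

theorem Cog.exists_terminal : ∀ {k : ℕ} {M : ModuleCat.{0} R}, Cog A Q Z k M →
    ∃ X, Z X ∧ Cog A Q (fun Y => Y = X) k M
  | 0, M, h => ⟨M, h, rfl⟩
  | _ + 1, _, ⟨I, C, i, p, h, hI, happ, hC⟩ => by
    obtain ⟨X, hX, hCX⟩ := hC.exists_terminal
    exact ⟨X, hX, I, C, i, p, h, hI, happ, hCX⟩

theorem Cog.prod (hQ : ProdClosed Q)
    (hZ : ∀ X Y, Z X → Z' Y → W (ModuleCat.of R (X × Y))) :
    ∀ {k : ℕ} {M N : ModuleCat.{0} R}, Cog A Q Z k M → Cog A Q Z' k N →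
      Cog A Q W k (ModuleCat.of R (M × N))
  | 0, _, _, h, h' => hZ _ _ h h'
  | _ + 1, M, N, ⟨I, C, i, p, h, hI, happ, hC⟩, ⟨I', C', i', p', h', hI', happ', hC'⟩ => by
    refine ⟨ModuleCat.of R (I × I'), ModuleCat.of R (C × C'), i.prodMap i', p.prodMap p',
      h.prodMap h', hQ hI hI', fun J hJ g => ?_, hC.prod hQ hZ hC'⟩
    obtain ⟨u, hu⟩ := happ J hJ (g ∘ₗ LinearMap.inl R M N)
    obtain ⟨v, hv⟩ := happ' J hJ (g ∘ₗ LinearMap.inr R M N)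
    refine ⟨u.coprod v, LinearMap.prod_ext ?_ ?_⟩
    · rw [← hu]
      ext x
      simp
    · rw [← hv]
      ext x
      simp

theorem cog_self (hQ : ProdClosed Q) {I : ModuleCat.{0} R} (hI : Q I) :
    ∀ k : ℕ, Cog A Q (fun Y => Y = I) k I
  | 0 => rfl
  | k + 1 => ⟨ModuleCat.of R (I × I), I, LinearMap.inl R I I, LinearMap.snd R I I, isSES_diag,
      hQ hI hI, fun _ _ g => ⟨g ∘ₗ LinearMap.fst R I I, by ext x; simp⟩, cog_self hQ hI k⟩

theorem Cog.prod_mem (hQ : ProdClosed Q) (hQZ : ∀ M, Q M → Z M) (hZ : ProdClosed Z) {k : ℕ}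
    {M I : ModuleCat.{0} R} (h : Cog A Q Z k M) (hI : Q I) :
    Cog A Q Z k (ModuleCat.of R (M × I)) :=
  h.prod hQ (Z' := fun Y => Y = I) (by rintro X _ hX rfl; exact hZ hX (hQZ _ hI))
    (cog_self hQ hI k)

theorem summandClosed_cog (hQ : ProdClosed Q) (hQZ : ∀ M, Q M → Z M) (hZ : ProdClosed Z)
    (hZs : SummandClosed Z) : ∀ k : ℕ, SummandClosed (Cog Q Q Z k)
  | 0 => hZs
  | k + 1 => by
    rintro M N ⟨ι, π, hπ⟩ ⟨I, C, i, p, h, hI, happ, hC⟩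
    have hι : Function.Injective ι :=
      Function.LeftInverse.injective (g := π) (LinearMap.congr_fun hπ)
    have h' := isSES_mkQ (i := i ∘ₗ ι) (h.inj.comp hι)
    refine ⟨I, ModuleCat.of R (I ⧸ LinearMap.range (i ∘ₗ ι)), i ∘ₗ ι, _, h', hI,
      fun J hJ g => ?_, ?_⟩
    · obtain ⟨u, hu⟩ := happ J hJ (g ∘ₗ π)
      refine ⟨u, ?_⟩
      rw [← LinearMap.comp_assoc, hu, LinearMap.comp_assoc, hπ, LinearMap.comp_id]
    · obtain ⟨b, hb⟩ := happ I hI ((i ∘ₗ ι) ∘ₗ π)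
      exact summandClosed_cog hQ hQZ hZ hZs k (N := ModuleCat.of R (C × I))
        (retract_coker h' h hπ (a := LinearMap.id) rfl hb) (hC.prod_mem hQ hQZ hZ hI)

theorem prodClosed_cog (hQ : ProdClosed Q) (hZ : ProdClosed Z) (k : ℕ) :
    ProdClosed (Cog A Q Z k) :=
  fun _ _ hM hN => hM.prod hQ (fun _ _ hX hY => hZ hX hY) hN

/-- Cokernels of arbitrary `Q`-approximations inherit coresolutions. -/
theorem Cog.coker (hQ : ProdClosed Q) (hQZ : ∀ M, Q M → Z M) (hZ : ProdClosed Z)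
    (hZs : SummandClosed Z) {k : ℕ} {M I C : ModuleCat.{0} R} (hM : Cog Q Q Z (k + 1) M)
    {i : M →ₗ[R] I} {p : I →ₗ[R] C} (h : IsSES i p) (hI : Q I)
    (happ : ∀ J : ModuleCat.{0} R, Q J → ∀ g : M →ₗ[R] J, ∃ h : I →ₗ[R] J, h ∘ₗ i = g) :
    Cog Q Q Z k C := by
  obtain ⟨I', C', i', p', h', hI', happ', hC'⟩ := hM
  obtain ⟨a, ha⟩ := happ I' hI' i'
  obtain ⟨b, hb⟩ := happ' I hI i
  exact summandClosed_cog hQ hQZ hZ hZs k (N := ModuleCat.of R (C' × I))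
    (retract_coker h h' (ι := LinearMap.id) (π := LinearMap.id) rfl ha hb)
    (hC'.prod_mem hQ hQZ hZ hI)

theorem Gen.prod (hQ : ProdClosed Q) (hZ : ProdClosed Z) :
    ∀ k : ℕ, ProdClosed (Gen Q Z k)
  | 0 => hZ
  | k + 1 => by
    rintro M N ⟨K, P, i, p, h, hP, hK⟩ ⟨K', P', i', p', h', hP', hK'⟩
    exact ⟨ModuleCat.of R (K × K'), ModuleCat.of R (P × P'), i.prodMap i', p.prodMap p',
      h.prodMap h', hQ hP hP', Gen.prod hQ hZ k hK hK'⟩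

theorem gen_self (hQ : ProdClosed Q) (hQZ : ∀ M, Q M → Z M) {P : ModuleCat.{0} R} (hP : Q P) :
    ∀ k : ℕ, Gen Q Z k P
  | 0 => hQZ P hP
  | k + 1 => ⟨P, ModuleCat.of R (P × P), LinearMap.inl R P P, LinearMap.snd R P P, isSES_diag,
      hQ hP hP, gen_self hQ hQZ hP k⟩

theorem summandClosed_gen (hQ : ProdClosed Q) (hQp : ∀ M, Q M → Module.Projective R M)
    (hQZ : ∀ M, Q M → Z M) (hZ : ProdClosed Z) (hZs : SummandClosed Z) :
    ∀ k : ℕ, SummandClosed (Gen Q Z k)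
  | 0 => hZs
  | k + 1 => by
    rintro M N ⟨ι, π, hπ⟩ ⟨K, P, i, p, h, hP, hK⟩
    have hπs : Function.Surjective π := fun x => ⟨ι x, LinearMap.congr_fun hπ x⟩
    have h' := isSES_ker (p := π ∘ₗ p) (hπs.comp h.surj)
    refine ⟨ModuleCat.of R (LinearMap.ker (π ∘ₗ p)), P, _, π ∘ₗ p, h', hP, ?_⟩
    have := hQp P hP
    obtain ⟨a, ha⟩ := Module.projective_lifting_property p (ι ∘ₗ π ∘ₗ p) h.surj
    exact summandClosed_gen hQ hQp hQZ hZ hZs k (N := ModuleCat.of R (K × P))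
      (retract_ker h' h hπ (b := LinearMap.id) ha rfl)
      (Gen.prod hQ hZ k hK (gen_self hQ hQZ hP k))

theorem Gen.mono (hQ : ∀ M, Q M → Q' M) (hZ : ∀ M, Z M → Z' M) :
    ∀ {k : ℕ} {M : ModuleCat.{0} R}, Gen Q Z k M → Gen Q' Z' k M
  | 0, _, h => hZ _ h
  | _ + 1, _, ⟨K, P, i, p, h, hP, hK⟩ => ⟨K, P, i, p, h, hQ P hP, hK.mono hQ hZ⟩

theorem Gen.exists_of_cog : ∀ {k j : ℕ} {M : ModuleCat.{0} R}, Gen Q Z j M → Cog A Q W k M →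
    ∃ X, W X ∧ Gen Q Z (j + k) X
  | 0, _, M, hM, h => ⟨M, h, hM⟩
  | k + 1, j, M, hM, ⟨I, C, i, p, h, hI, _, hC⟩ => by
    have hC' : Gen Q Z (j + 1) C := ⟨M, I, i, p, h, hI, hM⟩
    obtain ⟨X, hX, hX'⟩ := hC'.exists_of_cog hC
    exact ⟨X, hX, by rwa [Nat.add_right_comm, Nat.add_assoc] at hX'⟩

theorem Cog.exists_of_gen : ∀ {k j : ℕ} {X : ModuleCat.{0} R}, Cog noMod Q W j X →
    Gen Q Z k X → ∃ M, Z M ∧ Cog noMod Q W (j + k) M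
  | 0, _, X, hX, h => ⟨X, h, hX⟩
  | k + 1, j, X, hX, ⟨K, P, i, p, h, hP, hK⟩ => by
    have hK' : Cog noMod Q W (j + 1) K := ⟨P, X, i, p, h, hP, fun _ h => h.elim, hX⟩
    obtain ⟨M, hM, hM'⟩ := hK'.exists_of_gen hK
    exact ⟨M, hM, by rwa [Nat.add_right_comm, Nat.add_assoc] at hM'⟩

end PS

namespace PS
variable {R : Type} [Ring R] {A Q Z : ModuleCat.{0} R → Prop}

theorem exists_injective_desc {M N P : Type} [AddCommGroup M] [Module R M] [AddCommGroup N]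
    [Module R N] [AddCommGroup P] [Module R P] {g : M →ₗ[R] N} {f : N →ₗ[R] P}
    (h : Function.Exact g f) :
    ∃ g' : (N ⧸ LinearMap.range g) →ₗ[R] P,
      Function.Injective g' ∧ ∀ x, g' ((LinearMap.range g).mkQ x) = f x := by
  refine ⟨(LinearMap.range g).liftQ f h.linearMap_ker_eq.ge, ?_, fun x => rfl⟩
  rw [← LinearMap.ker_eq_bot, Submodule.ker_liftQ_eq_bot]
  exact h.linearMap_ker_eq.le

theorem exact_of_comp_surjective {N C P X : Type} [AddCommGroup N] [Module R N]
    [AddCommGroup C] [Module R C] [AddCommGroup P] [Module R P] [AddCommGroup X] [Module R X]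
    {q : N →ₗ[R] C} (hq : Function.Surjective q) {g : C →ₗ[R] P} {f : N →ₗ[R] P}
    (hg : ∀ x, g (q x) = f x) {u : P →ₗ[R] X} (h : Function.Exact f u) : Function.Exact g u := by
  intro y
  rw [h y]
  constructor
  · rintro ⟨x, rfl⟩
    exact ⟨q x, hg x⟩
  · rintro ⟨c, rfl⟩
    obtain ⟨x, rfl⟩ := hq c
    exact ⟨x, (hg x).symm⟩

/-- A finite exact sequence `0 → M → Y 0 → ⋯ → Y k → 0` gives a coresolution. -/
theorem cog_of_seq (hZ : SummandClosed Z) {k : ℕ} {M : ModuleCat.{0} R}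
    {Y : ℕ → ModuleCat.{0} R} (g : M →ₗ[R] Y 0) (f : ∀ i, Y i →ₗ[R] Y (i + 1))
    (hg : Function.Injective g) (hs₀ : k = 0 → Function.Surjective g)
    (hgf : 0 < k → Function.Exact g (f 0))
    (hf : ∀ i, i + 1 < k → Function.Exact (f i) (f (i + 1)))
    (hs : ∀ j, j + 1 = k → Function.Surjective (f j)) (hQ : ∀ i, i < k → Q (Y i))
    (hk : Z (Y k)) : Cog noMod Q Z k M := by
  induction k generalizing M Y with
  | zero => exact hZ (isSummand_of_equiv (LinearEquiv.ofBijective g ⟨hg, hs₀ rfl⟩)) hk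
  | succ k ih =>
    obtain ⟨g', hg'i, hg'⟩ := exists_injective_desc (hgf k.succ_pos)
    have hq := Submodule.mkQ_surjective (LinearMap.range g)
    refine ⟨Y 0, ModuleCat.of R (Y 0 ⧸ LinearMap.range g), g, _, isSES_mkQ hg,
      hQ 0 k.succ_pos, fun _ h => h.elim, ?_⟩
    refine ih (M := ModuleCat.of R (Y 0 ⧸ LinearMap.range g)) (Y := fun i => Y (i + 1)) g'
      (fun i => f (i + 1)) hg'i (fun h y => ?_)
      (fun h => exact_of_comp_surjective hq hg' (hf 0 (by omega)))
      (fun i hi => hf (i + 1) (by omega)) (fun j hj => hs (j + 1) (by omega))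
      (fun i hi => hQ (i + 1) (by omega)) hk
    obtain ⟨x, hx⟩ := hs 0 (by omega) y
    exact ⟨_, (hg' x).trans hx⟩

/-- An exact sequence `0 → M → Y 0 → ⋯ → Y (k-1)` gives a partial coresolution. -/
theorem cog_of_partial_seq {k : ℕ} {M : ModuleCat.{0} R}
    {Y : ℕ → ModuleCat.{0} R} (g : M →ₗ[R] Y 0) (f : ∀ i, Y i →ₗ[R] Y (i + 1))
    (hg : Function.Injective g) (hgf : 1 < k → Function.Exact g (f 0))
    (hf : ∀ i, i + 2 < k → Function.Exact (f i) (f (i + 1))) (hQ : ∀ i, i < k → Q (Y i)) :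
    Cog noMod Q allMod k M := by
  induction k generalizing M Y with
  | zero => trivial
  | succ k ih =>
    refine ⟨Y 0, ModuleCat.of R (Y 0 ⧸ LinearMap.range g), g, _, isSES_mkQ hg,
      hQ 0 k.succ_pos, fun _ h => h.elim, ?_⟩
    rcases k with _ | k
    · trivial
    obtain ⟨g', hg'i, hg'⟩ := exists_injective_desc (hgf (by omega))
    have hq := Submodule.mkQ_surjective (LinearMap.range g)
    exact ih (M := ModuleCat.of R (Y 0 ⧸ LinearMap.range g)) (Y := fun i => Y (i + 1)) g'
      (fun i => f (i + 1)) hg'i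
      (fun h => exact_of_comp_surjective hq hg' (hf 0 (by omega)))
      (fun i hi => hf (i + 1) (by omega)) (fun i hi => hQ (i + 1) (by omega))

theorem cog_of_isExactSeq (hZ : SummandClosed Z) {k : ℕ} {Y : ℕ → ModuleCat.{0} R}
    {f : ∀ i, Y i →ₗ[R] Y (i + 1)} (h : IsExactSeq (k + 1) Y f)
    (hQ : ∀ i, 1 ≤ i → i ≤ k → Q (Y i)) (hk : Z (Y (k + 1))) : Cog noMod Q Z k (Y 0) := by
  obtain ⟨h₁, h₂, h₃⟩ := h
  refine cog_of_seq hZ (Y := fun i => Y (i + 1)) (f 0) (fun i => f (i + 1)) h₁ ?_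
    (fun hk => h₃ 0 (by omega)) (fun i hi => h₃ (i + 1) (by omega)) ?_
    (fun i hi => hQ (i + 1) (by omega) (by omega)) hk
  · rintro rfl
    exact h₂
  · rintro j rfl
    exact h₂

theorem MemCogenShift.cog {k : ℕ} {X M : ModuleCat.{0} R} (h : MemCogenShift k X M) :
    Cog noMod (MemAdd X) allMod k M := by
  rcases k with _ | k
  · trivial
  obtain ⟨Y, f, h₁, rfl, h₂, h₃⟩ := h
  exact cog_of_partial_seq (Y := fun i => Y (i + 1)) (f 0) (fun i => f (i + 1)) h₂
    (fun hk => h₃ 0 (by omega)) (fun i hi => h₃ (i + 1) (by omega))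
    (fun i hi => h₁ (i + 1) (by omega) (by omega))

theorem DomdimGE.cog {k : ℕ} (h : DomdimGE R k) : Cog noMod ProjInj allMod k (reg R) := by
  obtain ⟨Y, g, f, h₁, h₂, h₃, h₄, h₅⟩ := h
  exact cog_of_partial_seq g f h₁ (fun _ => h₂) (fun i _ => h₃ i) (fun i hi => ⟨h₅ i hi, h₄ i⟩)

theorem IdimLE.cog {k : ℕ} {M : ModuleCat.{0} R} (h : IdimLE k M) :
    Cog noMod (fun M => Module.Injective R M) (fun M => Module.Injective R M) k M := by
  obtain ⟨Y, f, h₁, h₂, rfl⟩ := h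
  exact cog_of_isExactSeq summandClosed_injective h₁ (fun i h h' => h₂ i h (by omega))
    (h₂ _ (by omega) le_rfl)

theorem IsTilting.cog {k : ℕ} {T : ModuleCat.{0} R} (h : IsTilting k T) :
    Cog noMod (MemAdd T) (MemAdd T) k (reg R) := by
  obtain ⟨-, -, -, Y, f, h₁, h₂, h₃⟩ := h
  rw [← h₂]
  exact cog_of_isExactSeq (summandClosed_memAdd T) h₁ (fun i h h' => h₃ i h (by omega))
    (h₃ _ (by omega) le_rfl)

theorem gen_congr {k : ℕ} {M N : ModuleCat.{0} R} (e : M ≃ₗ[R] N)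
    (h : Gen Q Z (k + 1) M) : Gen Q Z (k + 1) N := by
  obtain ⟨K, P, i, p, h, hP, hK⟩ := h
  refine ⟨K, P, i, e.toLinearMap ∘ₗ p, ⟨h.inj, fun x => ?_, e.surjective.comp h.surj⟩, hP, hK⟩
  simp [← h.exact x]

theorem gen_range {Y : ℕ → ModuleCat.{0} R} (f : ∀ i, Y i →ₗ[R] Y (i + 1)) :
    ∀ k : ℕ, (∀ i, i ≤ k → Q (Y i)) → (∀ i, i < k → Function.Exact (f i) (f (i + 1))) →
      Gen Q allMod (k + 1) (ModuleCat.of R (LinearMap.range (f k)))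
  | 0, hQ, _ => ⟨ModuleCat.of R (LinearMap.ker (f 0).rangeRestrict), Y 0,
      (LinearMap.ker (f 0).rangeRestrict).subtype, (f 0).rangeRestrict,
      isSES_ker (f 0).surjective_rangeRestrict,
      hQ 0 le_rfl, trivial⟩
  | k + 1, hQ, hf => by
    refine ⟨ModuleCat.of R (LinearMap.range (f k)), Y (k + 1), (LinearMap.range (f k)).subtype,
      (f (k + 1)).rangeRestrict,
      ⟨Subtype.val_injective, fun x => ?_, LinearMap.surjective_rangeRestrict _⟩,
      hQ _ le_rfl, gen_range f k (fun i hi => hQ i (by omega)) fun i hi => hf i (by omega)⟩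
    have := hf k (by omega) x
    rw [Submodule.coe_subtype, Subtype.range_coe_subtype, Set.mem_ofPred_eq]
    exact Iff.trans (by rw [Subtype.ext_iff]; rfl) this

theorem MemGenShift.gen {k : ℕ} {X M : ModuleCat.{0} R} (h : MemGenShift k X M) :
    Gen (MemAdd X) allMod k M := by
  rcases k with _ | k
  · trivial
  obtain ⟨Y, f, h₁, rfl, h₂, h₃⟩ := h
  exact gen_congr (LinearEquiv.ofTop _ (LinearMap.range_eq_top.2 h₂)) (gen_range f k h₁ h₃)

/-- Prepend a module to a sequence of modules. -/
def consSeq (I : ModuleCat.{0} R) (Y : ℕ → ModuleCat.{0} R) : ℕ → ModuleCat.{0} R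
  | 0 => I
  | i + 1 => Y i

/-- Prepend a map to a sequence of maps. -/
def consMap {I : ModuleCat.{0} R} {Y : ℕ → ModuleCat.{0} R} (g : I →ₗ[R] Y 0)
    (f : ∀ i, Y i →ₗ[R] Y (i + 1)) : ∀ i, consSeq I Y i →ₗ[R] consSeq I Y (i + 1)
  | 0 => g
  | i + 1 => f i

theorem IsSES.exact_comp {M N P X : Type} [AddCommGroup M] [Module R M] [AddCommGroup N]
    [Module R N] [AddCommGroup P] [Module R P] [AddCommGroup X] [Module R X] {i : M →ₗ[R] N}
    {p : N →ₗ[R] P} (h : IsSES i p) {g : P →ₗ[R] X} (hg : Function.Injective g) :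
    Function.Exact i (g ∘ₗ p) := by
  intro x
  rw [← h.exact x, LinearMap.comp_apply, map_eq_zero_iff g hg]

/-- A coresolution gives an exact sequence. -/
theorem Cog.exists_isExactSeq : ∀ {k : ℕ} {M : ModuleCat.{0} R}, Cog A Q Z k M →
    ∃ (Y : ℕ → ModuleCat.{0} R) (f : ∀ i, Y i →ₗ[R] Y (i + 1)), IsExactSeq (k + 1) Y f ∧
      Y 0 = M ∧ (∀ i, 1 ≤ i → i ≤ k → Q (Y i)) ∧ Z (Y (k + 1))
  | 0, M, h => ⟨fun _ => M, fun _ => LinearMap.id,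
      ⟨Function.injective_id, Function.surjective_id, fun i hi => by omega⟩, rfl,
      fun i h h' => by omega, h⟩
  | k + 1, M, ⟨I, C, i, p, h, hI, _, hC⟩ => by
    obtain ⟨Y, f, ⟨h₁, h₂, h₃⟩, rfl, h₅, h₆⟩ := hC.exists_isExactSeq
    refine ⟨consSeq M (consSeq I fun i => Y (i + 1)),
      consMap (Y := consSeq I fun i => Y (i + 1)) i
        (consMap (Y := fun i => Y (i + 1)) (f 0 ∘ₗ p) fun i => f (i + 1)),
      ⟨h.inj, ?_, ?_⟩, rfl, ?_, h₆⟩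
    · rcases k with _ | k
      · exact (show Function.Surjective (f 0) from h₂).comp h.surj
      · exact h₂
    · rintro (_ | _ | j) hj
      · exact h.exact_comp h₁
      · have := h₃ 0 (by omega)
        intro x
        refine (this x).trans ⟨?_, ?_⟩
        · rintro ⟨c, rfl⟩
          obtain ⟨y, rfl⟩ := h.surj c
          exact ⟨y, rfl⟩
        · rintro ⟨y, rfl⟩
          exact ⟨p y, rfl⟩
      · exact h₃ (j + 1) (by omega)
    · rintro (_ | _ | j) hj hj'
      · omega
      · exact hI
      · exact h₅ (j + 1) (by omega) (by omega)

theorem Cog.idimLE {k : ℕ} {M : ModuleCat.{0} R}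
    (h : Cog A (fun M => Module.Injective R M) (fun M => Module.Injective R M) k M) :
    IdimLE k M := by
  obtain ⟨Y, f, h₁, h₂, h₃, h₄⟩ := h.exists_isExactSeq
  refine ⟨Y, f, h₁, fun i hi hi' => ?_, h₂⟩
  obtain rfl | hk := eq_or_lt_of_le hi'
  · exact h₄
  · exact h₃ i hi (by omega)

theorem Cog.pdimLE {k : ℕ} {M T : ModuleCat.{0} R} (hM : Module.Projective R M)
    (h : Cog A (fun M => Module.Projective R M) (fun Y => Y = T) k M) : PdimLE k T := by
  obtain ⟨Y, f, h₁, rfl, h₃, h₄⟩ := h.exists_isExactSeq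
  refine ⟨Y, f, h₁, fun i hi => ?_, h₄⟩
  rcases i with _ | i
  · exact hM
  · exact h₃ _ (by omega) hi

theorem Cog.memGenShift {k : ℕ} {M X T : ModuleCat.{0} R}
    (h : Cog A (MemAdd X) (fun Y => Y = T) k M) : MemGenShift k X T := by
  rcases k with _ | k
  · trivial
  obtain ⟨Y, f, ⟨-, h₁, h₂⟩, -, h₃, h₄⟩ := h.exists_isExactSeq
  exact ⟨fun i => Y (i + 1), fun i => f (i + 1), fun i hi => h₃ _ (by omega) (by omega), h₄,
    h₁, fun i hi => h₂ _ (by omega)⟩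

theorem Cog.memCogenShift {k : ℕ} {M X : ModuleCat.{0} R}
    (h : Cog A (MemAdd X) Z k M) : MemCogenShift k X M := by
  rcases k with _ | k
  · trivial
  obtain ⟨Y, f, ⟨h₁, -, h₂⟩, h₃, h₄, -⟩ := h.exists_isExactSeq
  exact ⟨Y, f, h₄, h₃, h₁, fun i hi => h₂ _ (by omega)⟩

theorem exists_injective_embedding (M : ModuleCat.{0} R) :
    ∃ (I : ModuleCat.{0} R) (i : M →ₗ[R] I), Function.Injective i ∧ Module.Injective R I := by
  refine ⟨Injective.under (C := ModuleCat.{0} R) M, (Injective.ι M).hom, ?_, ?_⟩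
  · exact (ModuleCat.mono_iff_injective _).1 inferInstance
  · exact (Module.injective_iff_injective_object R (Injective.under (C := ModuleCat.{0} R) M)).2
      (inferInstanceAs (Injective (Injective.under (C := ModuleCat.{0} R) M)))

/-- Every module has an injective resolution. -/
theorem exists_injective_resolution (M : ModuleCat.{0} R) :
    ∃ (Y : ℕ → ModuleCat.{0} R) (g : M →ₗ[R] Y 0) (f : ∀ i, Y i →ₗ[R] Y (i + 1)),
      Function.Injective g ∧ Function.Exact g (f 0) ∧
      (∀ i, Function.Exact (f i) (f (i + 1))) ∧ ∀ i, Module.Injective R (Y i) := by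
  choose I e he hI using exists_injective_embedding (R := R)
  let C : ℕ → ModuleCat.{0} R := fun n =>
    Nat.rec (motive := fun _ => ModuleCat.{0} R) M
      (fun _ X => ModuleCat.of R (I X ⧸ LinearMap.range (e X))) n
  let q : ∀ n, I (C n) →ₗ[R] C (n + 1) := fun n =>
    (LinearMap.range (M₂ := I (C n)) (e (C n))).mkQ
  have hq : ∀ n, IsSES (e (C n)) (q n) := fun n => isSES_mkQ (he (C n))
  refine ⟨fun n => I (C n), e M, fun n => e (C (n + 1)) ∘ₗ q n, he M,
    (hq 0).exact_comp (he _), fun n => ?_, fun n => hI _⟩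
  have := (hq (n + 1)).exact_comp (he (C (n + 2)))
  intro x
  refine (this x).trans ⟨?_, ?_⟩
  · rintro ⟨c, rfl⟩
    obtain ⟨y, rfl⟩ := (hq n).surj c
    exact ⟨y, rfl⟩
  · rintro ⟨y, rfl⟩
    exact ⟨q n y, rfl⟩

theorem Cog.exists_resolution : ∀ {k : ℕ} {M : ModuleCat.{0} R}, Cog A ProjInj Z k M →
    ∃ (Y : ℕ → ModuleCat.{0} R) (g : M →ₗ[R] Y 0) (f : ∀ i, Y i →ₗ[R] Y (i + 1)),
      Function.Injective g ∧ Function.Exact g (f 0) ∧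
      (∀ i, Function.Exact (f i) (f (i + 1))) ∧ (∀ i, Module.Injective R (Y i)) ∧
      ∀ i, i < k → Module.Projective R (Y i)
  | 0, M, _ => by
    obtain ⟨Y, g, f, h₁, h₂, h₃, h₄⟩ := exists_injective_resolution M
    exact ⟨Y, g, f, h₁, h₂, h₃, h₄, fun i hi => by omega⟩
  | k + 1, M, ⟨I, C, i, p, h, hI, _, hC⟩ => by
    obtain ⟨Y, g, f, h₁, h₂, h₃, h₄, h₅⟩ := hC.exists_resolution
    refine ⟨consSeq I Y, i, consMap (g ∘ₗ p) f, h.inj, h.exact_comp h₁, ?_, ?_, ?_⟩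
    · rintro (_ | j)
      · intro x
        refine (h₂ x).trans ⟨?_, ?_⟩
        · rintro ⟨c, rfl⟩
          obtain ⟨y, rfl⟩ := h.surj c
          exact ⟨y, rfl⟩
        · rintro ⟨y, rfl⟩
          exact ⟨p y, rfl⟩
      · exact h₃ j
    · rintro (_ | j)
      · exact hI.2
      · exact h₄ j
    · rintro (_ | j) hj
      · exact hI.1
      · exact h₅ j (by omega)

theorem Cog.domdimGE {k : ℕ} (h : Cog A ProjInj Z k (reg R)) : DomdimGE R k :=
  h.exists_resolution

end PS

namespace PS
variable {R : Type} [Ring R] {A Q Z : ModuleCat.{0} R → Prop}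

theorem exists_extension_of_memAdd {T J X Y : ModuleCat.{0} R} (hJ : MemAdd T J)
    {i : X →ₗ[R] Y} (h : ∀ g : X →ₗ[R] T, ∃ h : Y →ₗ[R] T, h ∘ₗ i = g) (g : X →ₗ[R] J) :
    ∃ h : Y →ₗ[R] J, h ∘ₗ i = g := by
  obtain ⟨κ, _, a, b, hab⟩ := memAdd_iff_sum.1 hJ
  choose u hu using fun k => h (a k ∘ₗ g)
  refine ⟨∑ k, b k ∘ₗ u k, ?_⟩
  ext x
  have hu' : ∀ k, u k (i x) = a k (g x) := fun k => LinearMap.congr_fun (hu k) x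
  have := LinearMap.congr_fun hab (g x)
  simpa [hu'] using this

/-- A finite `add T`-coresolution consists of `add T`-approximations if `T` is rigid. -/
theorem Cog.approx_of_rigid {T : ModuleCat.{0} R} (hT : LeftPerp T T) :
    ∀ {k : ℕ} {M : ModuleCat.{0} R}, Cog noMod (MemAdd T) (MemAdd T) k M →
      LeftPerp T M ∧ Cog (MemAdd T) (MemAdd T) (MemAdd T) k M
  | 0, _, h => ⟨of_memAdd (summandClosed_leftPerp T) (prodClosed_leftPerp T) hT h, h⟩
  | _ + 1, _, ⟨I, C, i, p, h, hI, _, hC⟩ => by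
    obtain ⟨hC₁, hC₂⟩ := hC.approx_of_rigid hT
    refine ⟨leftPerp_left h.inj h.exact h.surj
      (of_memAdd (summandClosed_leftPerp T) (prodClosed_leftPerp T) hT hI) hC₁,
      I, C, i, p, h, hI, fun J hJ => exists_extension_of_memAdd hJ
        (exists_extension_of_leftPerp h.inj h.exact h.surj hC₁), hC₂⟩

theorem Gen.pred : ∀ {k : ℕ} {M : ModuleCat.{0} R}, Gen Q allMod (k + 1) M → Gen Q allMod k M
  | 0, _, _ => trivial
  | _ + 1, _, ⟨K, P, i, p, h, hP, hK⟩ => ⟨K, P, i, p, h, hP, hK.pred⟩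

theorem Gen.of_le {j k : ℕ} (hjk : j ≤ k) {M : ModuleCat.{0} R} (h : Gen Q allMod k M) :
    Gen Q allMod j M := by
  induction hjk with
  | refl => exact h
  | step _ ih => exact ih h.pred

/-- `f` factors through a module in `add X`. -/
def FactorsAdd (X : ModuleCat.{0} R) {M N : ModuleCat.{0} R} (f : M →ₗ[R] N) : Prop :=
  ∃ (W : ModuleCat.{0} R) (u : M →ₗ[R] W) (v : W →ₗ[R] N), MemAdd X W ∧ v ∘ₗ u = f

/-- Every map from `M` to a module in `gen_a(X)` factors through `add X`. -/
def GenFactors (X : ModuleCat.{0} R) (a : ℕ) (M : ModuleCat.{0} R) : Prop :=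
  ∀ K, Gen (MemAdd X) allMod (a + 1) K → ∀ f : M →ₗ[R] K, FactorsAdd X f

theorem genFactors_zero (X : ModuleCat.{0} R) {M : ModuleCat.{0} R}
    (hM : Module.Projective R M) : GenFactors X 0 M := by
  rintro K ⟨L, P, i, p, h, hP, -⟩ f
  obtain ⟨g, hg⟩ := Module.projective_lifting_property p f h.surj
  exact ⟨P, g, p, hP, hg⟩

theorem GenFactors.succ {X : ModuleCat.{0} R} (hX : ProjInj X) {a : ℕ}
    {M W N : ModuleCat.{0} R} (hM : GenFactors X a M) (hW : MemAdd X W) {i : M →ₗ[R] W}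
    {p : W →ₗ[R] N} (h : IsSES i p) : GenFactors X (a + 1) N := by
  rintro K ⟨L, P, j, q, h', hP, hL⟩ f
  have := (hX.of_memAdd hW).1
  obtain ⟨g, hg⟩ := Module.projective_lifting_property q (f ∘ₗ p) h'.surj
  have hg' : ∀ x, q (g x) = f (p x) := LinearMap.congr_fun hg
  obtain ⟨k, hk⟩ := exists_lift_of_exact h'.inj h'.exact (g ∘ₗ i)
    (by ext x; simp [hg', h.exact.apply_apply_eq_zero])
  obtain ⟨W₁, u, v, hW₁, rfl⟩ := hM L hL k
  obtain ⟨u', rfl⟩ := exists_extension_of_injective (hX.of_memAdd hW₁).2 h.inj u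
  obtain ⟨s, hs⟩ := exists_desc_of_exact h.exact h.surj (g - j ∘ₗ v ∘ₗ u')
    (by rw [LinearMap.sub_comp, ← hk]; exact sub_self _)
  refine ⟨P, s, q, hP, comp_eq_comp_of_surjective h.surj ?_⟩
  rw [LinearMap.comp_assoc, hs, ← hg]
  ext x
  simp [h'.exact.apply_apply_eq_zero]

/-- If `T ∈ gen_{m-1}(X)`, an `add T`-approximation coresolution can be replaced by one whose
middle terms are in `add X`. -/
theorem Cog.special {X T : ModuleCat.{0} R} (hX : ProjInj X) (hXT : MemAdd T X) {m : ℕ}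
    (hT : Gen (MemAdd X) allMod m T) :
    ∀ {j a : ℕ} {M : ModuleCat.{0} R}, a + j = m → GenFactors X a M →
      Cog (MemAdd T) (MemAdd T) (MemAdd T) j M → Cog noMod (MemAdd X) (MemAdd T) j M
  | 0, _, _, _, _, h => h
  | j + 1, a, M, haj, hM, hc => by
    have hc' := hc
    obtain ⟨I, C, i, p, h, hI, happ, -⟩ := hc'
    have hI' : Gen (MemAdd X) allMod (a + 1) I :=
      of_memAdd (summandClosed_gen (prodClosed_memAdd X) (fun M hM => (hX.of_memAdd hM).1)
        (fun _ _ => trivial) (fun _ _ _ _ => trivial) (fun _ _ _ _ => trivial) (a + 1))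
        (Gen.prod (prodClosed_memAdd X) (fun _ _ _ _ => trivial) (a + 1))
        (hT.of_le (by omega)) hI
    obtain ⟨W, u, v, hW, rfl⟩ := hM I hI' i
    have hu : IsSES u (LinearMap.range u).mkQ := isSES_mkQ (Function.Injective.of_comp h.inj)
    refine ⟨W, ModuleCat.of R (W ⧸ LinearMap.range u), u, _, hu, hW, fun _ h => h.elim, ?_⟩
    refine Cog.special (a := a + 1) hX hXT hT (by omega) (hM.succ hX hW hu) ?_
    refine hc.coker (C := ModuleCat.of R (W ⧸ LinearMap.range u)) (prodClosed_memAdd T)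
      (fun _ h => h) (prodClosed_memAdd T) (summandClosed_memAdd T) hu (hW.trans hXT)
      fun J hJ g => ?_
    obtain ⟨g', rfl⟩ := happ J hJ g
    exact ⟨g' ∘ₗ v, rfl⟩

theorem memAdd_of_cog_reg {X T : ModuleCat.{0} R} (hX : IsSummand X (reg R))
    (hXi : Module.Injective R X) :
    ∀ {k : ℕ}, Cog noMod (MemAdd T) (MemAdd T) k (reg R) → MemAdd T X
  | 0, h => summandClosed_memAdd T hX h
  | _ + 1, ⟨I, C, i, p, h, hI, _, _⟩ => by
    obtain ⟨ι, π, hπ⟩ := hX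
    have hι : Function.Injective ι :=
      Function.LeftInverse.injective (g := π) (LinearMap.congr_fun hπ)
    obtain ⟨r, hr⟩ := exists_extension_of_injective hXi (i := i ∘ₗ ι) (h.inj.comp hι)
      LinearMap.id
    exact summandClosed_memAdd T ⟨i ∘ₗ ι, r, hr⟩ hI

/-- A tilting and cotilting module in `gen_{m-1}(Π) ∩ cogen^{n-1}(Π)` bounds the injective
dimension and the dominant dimension. -/
theorem idimLE_domdimGE_of_tilting {P T : ModuleCat.{0} R} (hP : IsMaxProjInjSummand P)
    {m n : ℕ} (hg : MemGenShift m P T) (hc : MemCogenShift n P T) (ht : IsTilting m T)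
    (hi : IdimLE n T) : IdimLE (m + n) (reg R) ∧ DomdimGE R (m + n) := by
  obtain ⟨hPs, hPp, -⟩ := hP
  have hR : Module.Projective R (reg R) := (inferInstance : Module.Projective R R)
  have hPT : MemAdd T P := memAdd_of_cog_reg hPs hPp.2 ht.cog
  have hs : Cog noMod (MemAdd P) (MemAdd T) m (reg R) :=
    Cog.special hPp hPT hg.gen (Nat.zero_add m) (genFactors_zero P hR)
      (ht.cog.approx_of_rigid ((extVanishing_iff_leftPerp T T).1 ht.2.2.1)).2
  have h₁ : ∀ M, MemAdd T M → Cog noMod ProjInj allMod n M := fun M hM =>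
    (of_memAdd (summandClosed_cog prodClosed_projInj (fun _ _ => trivial)
      (fun _ _ _ _ => trivial) (fun _ _ _ _ => trivial) n)
      (prodClosed_cog prodClosed_projInj (fun _ _ _ _ => trivial) n)
      ((hc.cog.mono (fun _ h => h) (fun M hM => hPp.of_memAdd hM)
        (fun _ h => h)).approx_of_injective fun M hM => hM.2) hM).weaken
  have h₂ : ∀ M, MemAdd T M → Cog noMod (fun M => Module.Injective R M)
      (fun M => Module.Injective R M) n M := fun M hM =>
    (of_memAdd (summandClosed_cog prodClosed_injective (fun _ h => h)
      prodClosed_injective summandClosed_injective n)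
      (prodClosed_cog prodClosed_injective prodClosed_injective n)
      (hi.cog.approx_of_injective fun M hM => hM) hM).weaken
  exact ⟨(cog_append (hs.mono (fun _ h => h) (fun M hM => (hPp.of_memAdd hM).2) h₂)).idimLE,
    (cog_append (hs.mono (fun _ h => h) (fun M hM => hPp.of_memAdd hM) h₁)).domdimGE⟩

end PS

namespace PS
variable {R : Type} [Ring R]

section Indecomposable

/-- A primitive idempotent of a ring. -/
def IsPrimitiveIdem {S : Type} [Ring S] (e : S) : Prop :=
  e ≠ 0 ∧ e * e = e ∧ ∀ f : S, f * f = f → f * e = f → e * f = f → f = 0 ∨ f = e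

theorem IsPrimitiveIdem.map {S S' : Type} [Ring S] [Ring S'] (φ : S ≃+* S') {e : S}
    (he : IsPrimitiveIdem e) : IsPrimitiveIdem (φ e) := by
  obtain ⟨h₁, h₂, h₃⟩ := he
  refine ⟨by simpa using h₁, by rw [← map_mul, h₂], fun f hf hfe hef => ?_⟩
  have key := h₃ (φ.symm f) (by rw [← map_mul, hf])
    (by rw [← φ.symm_apply_apply e, ← map_mul, hfe])
    (by rw [← φ.symm_apply_apply e, ← map_mul, hef])
  rcases key with h | h
  · left
    simpa using h
  · right
    rw [← h, φ.apply_symm_apply]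

/-- A nonzero module whose only idempotent endomorphisms are `0` and `1`. -/
def Indec (R M : Type) [Ring R] [AddCommGroup M] [Module R M] : Prop :=
  Nontrivial M ∧ ∀ e : Module.End R M, e * e = e → e = 0 ∨ e = 1

variable {M : Type} [AddCommGroup M] [Module R M]

theorem apply_of_mem_range_idem {e : Module.End R M} (he : e * e = e) {x : M}
    (hx : x ∈ LinearMap.range e) : e x = x := by
  obtain ⟨y, rfl⟩ := hx
  exact LinearMap.congr_fun he y

theorem IsPrimitiveIdem.indec_range {e : Module.End R M} (he : IsPrimitiveIdem e) :
    Indec R (LinearMap.range e) := by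
  obtain ⟨h₁, h₂, h₃⟩ := he
  have hfix : ∀ y : LinearMap.range e, e y = y := fun y => apply_of_mem_range_idem h₂ y.2
  have hres : ∀ y : LinearMap.range e, e.rangeRestrict y = y := fun y => Subtype.ext (hfix y)
  constructor
  · by_contra h
    rw [not_nontrivial_iff_subsingleton] at h
    refine h₁ (LinearMap.ext fun x => ?_)
    exact congrArg Subtype.val (Subsingleton.elim (e.rangeRestrict x) 0)
  · intro f hf
    have hf' : ∀ y, f (f y) = f y := LinearMap.congr_fun hf
    let g : Module.End R M := (LinearMap.range e).subtype ∘ₗ f ∘ₗ e.rangeRestrict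
    have hg : ∀ x, g x = f (e.rangeRestrict x) := fun _ => rfl
    have key := h₃ g
      (by ext x; simp only [Module.End.mul_apply, hg, hres, hf'])
      (by
        ext x
        have : e.rangeRestrict (e x) = e.rangeRestrict x :=
          Subtype.ext (LinearMap.congr_fun h₂ x)
        simp only [Module.End.mul_apply, hg, this])
      (by ext x; simp only [Module.End.mul_apply, hg, hfix])
    rcases key with h | h
    · left
      ext y
      have := LinearMap.congr_fun h y
      rw [hg, hres] at this
      exact this
    · right
      ext y
      have := LinearMap.congr_fun h y
      rw [hg, hres, hfix] at this
      exact this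

/-- Decomposition of an idempotent into orthogonal primitive idempotents. -/
theorem exists_primitive_decomposition [IsArtinian R M] (e : Module.End R M) (he : e * e = e) :
    ∃ (ι : Type) (_ : Fintype ι) (_ : DecidableEq ι) (f : ι → Module.End R M),
      (∀ i, IsPrimitiveIdem (f i)) ∧ (∀ i j, i ≠ j → f i * f j = 0) ∧ ∑ i, f i = e := by
  induction hN : LinearMap.range e using WellFoundedLT.induction generalizing e with
  | ind N ih =>
    subst hN
    by_cases h0 : e = 0
    · exact ⟨Empty, inferInstance, inferInstance, Empty.elim, fun i => i.elim,
        fun i => i.elim, by simp [h0]⟩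
    by_cases hp : IsPrimitiveIdem e
    · exact ⟨Unit, inferInstance, inferInstance, fun _ => e, fun _ => hp,
        fun i j h => (h rfl).elim, by simp⟩
    simp only [IsPrimitiveIdem, not_and, not_forall, not_or] at hp
    obtain ⟨f, hf, hfe, hef, hf0, hf1⟩ := hp h0 he
    have step : ∀ g : Module.End R M, g * g = g → g * e = g → e * g = g → g ≠ e →
        LinearMap.range g < LinearMap.range e := by
      intro g hg hge heg hne
      refine lt_of_le_of_ne ?_ fun h => hne ?_
      · rw [← heg]
        exact LinearMap.range_comp_le_range _ _
      · rw [← hge]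
        ext x
        exact apply_of_mem_range_idem hg (h ▸ LinearMap.mem_range_self e x)
    have hg : (e - f) * (e - f) = e - f := by simp [mul_sub, sub_mul, he, hf, hfe, hef]
    obtain ⟨ι, _, _, u, hu₁, hu₂, hu₃⟩ := ih _ (step f hf hfe hef hf1) f hf rfl
    obtain ⟨κ, _, _, v, hv₁, hv₂, hv₃⟩ := ih _ (step (e - f) hg (by simp [sub_mul, he, hfe])
      (by simp [mul_sub, he, hef]) (by simpa using hf0)) (e - f) hg rfl
    have hul : ∀ i, u i * f = u i := by
      intro i
      rw [← hu₃, Finset.mul_sum, Finset.sum_eq_single i (fun j _ h => hu₂ i j h.symm) (by simp)]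
      exact (hu₁ i).2.1
    have hur : ∀ i, f * u i = u i := by
      intro i
      rw [← hu₃, Finset.sum_mul, Finset.sum_eq_single i (fun j _ h => hu₂ j i h) (by simp)]
      exact (hu₁ i).2.1
    have hvl : ∀ i, v i * (e - f) = v i := by
      intro i
      rw [← hv₃, Finset.mul_sum, Finset.sum_eq_single i (fun j _ h => hv₂ i j h.symm) (by simp)]
      exact (hv₁ i).2.1
    have hvr : ∀ i, (e - f) * v i = v i := by
      intro i
      rw [← hv₃, Finset.sum_mul, Finset.sum_eq_single i (fun j _ h => hv₂ j i h) (by simp)]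
      exact (hv₁ i).2.1
    refine ⟨ι ⊕ κ, inferInstance, inferInstance, Sum.elim u v, ?_, ?_, ?_⟩
    · rintro (i | i)
      · exact hu₁ i
      · exact hv₁ i
    · rintro (i | i) (j | j) h
      · exact hu₂ i j fun h' => h (congrArg _ h')
      · change u i * v j = 0
        rw [← hul i, ← hvr j, mul_assoc, ← mul_assoc f, mul_sub, hf, hfe]
        simp
      · change v i * u j = 0
        rw [← hvl i, ← hur j, mul_assoc, ← mul_assoc (e - f), sub_mul, hf, hef]
        simp
      · exact hv₂ i j fun h' => h (congrArg _ h')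
    · simp [hu₃, hv₃]

/-- The Fitting lemma for indecomposable modules. -/
theorem Indec.isUnit_or_isNilpotent [IsArtinian R M] [IsNoetherian R M] (hM : Indec R M)
    (f : Module.End R M) : IsUnit f ∨ IsNilpotent f := by
  obtain ⟨n, hn, hn1⟩ := ((LinearMap.eventually_isCompl_ker_pow_range_pow f).and
    (Filter.eventually_ge_atTop 1)).exists
  have hr := Submodule.range_projection hn
  rcases hM.2 _ (Submodule.isIdempotentElem_projection hn) with h | h
  · left
    rw [h, LinearMap.range_zero] at hr
    have h' := hn.sup_eq_top
    rw [← hr, bot_sup_eq] at h'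
    rw [← isUnit_pow_iff (Nat.one_le_iff_ne_zero.1 hn1), Module.End.isUnit_iff]
    exact ⟨LinearMap.ker_eq_bot.1 hr.symm, LinearMap.range_eq_top.1 h'⟩
  · right
    rw [h, Module.End.one_eq_id, LinearMap.range_id] at hr
    exact ⟨n, LinearMap.ker_eq_top.1 hr.symm⟩

theorem Indec.isLocalRing [IsArtinian R M] [IsNoetherian R M] (hM : Indec R M) :
    IsLocalRing (Module.End R M) := by
  have := hM.1
  refine ⟨fun {a b} hab => (hM.isUnit_or_isNilpotent a).imp id fun ha => ?_⟩
  rw [eq_sub_of_add_eq' hab]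
  exact ha.isUnit_one_sub

theorem exists_isUnit_of_isUnit_sum {S : Type} [Ring S] [IsLocalRing S] {ι : Type}
    (s : Finset ι) (f : ι → S) (h : IsUnit (∑ i ∈ s, f i)) : ∃ i ∈ s, IsUnit (f i) := by
  classical
  induction s using Finset.induction_on with
  | empty => simp at h
  | insert a s ha ih =>
    rw [Finset.sum_insert ha] at h
    obtain ⟨u, hu⟩ := h
    have : ↑u⁻¹ * f a + ↑u⁻¹ * ∑ i ∈ s, f i = 1 := by rw [← mul_add, ← hu, Units.inv_mul]
    rcases IsLocalRing.isUnit_or_isUnit_of_add_one this with h | h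
    · exact ⟨a, by simp, by simpa using h⟩
    · obtain ⟨i, hi, hi'⟩ := ih (by simpa using h)
      exact ⟨i, by simp [hi], hi'⟩

end Indecomposable

section Summands
variable {R : Type} [Ring R]

theorem isSummand_of_isUnit {M N : ModuleCat.{0} R} (a : M →ₗ[R] N) (b : N →ₗ[R] M)
    (h : IsUnit (b ∘ₗ a : Module.End R M)) : IsSummand M N := by
  obtain ⟨u, hu⟩ := h
  refine ⟨a, (↑u⁻¹ : Module.End R M) ∘ₗ b, ?_⟩
  rw [LinearMap.comp_assoc, ← hu]
  exact u.inv_mul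

theorem isSummand_range {M : ModuleCat.{0} R} {e : Module.End R M} (he : e * e = e) :
    IsSummand (ModuleCat.of R (LinearMap.range e)) M :=
  ⟨(LinearMap.range e).subtype, e.rangeRestrict,
    LinearMap.ext fun y => Subtype.ext (apply_of_mem_range_idem he y.2)⟩

theorem Indec.exists_isSummand {M : ModuleCat.{0} R} [IsArtinian R M] [IsNoetherian R M]
    (hM : Indec R M) {ι : Type} [Fintype ι] (N : ι → ModuleCat.{0} R)
    (a : ∀ k, M →ₗ[R] N k) (b : ∀ k, N k →ₗ[R] M)
    (h : ∑ k, b k ∘ₗ a k = LinearMap.id) : ∃ k, IsSummand M (N k) := by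
  have := hM.isLocalRing
  obtain ⟨k, -, hk⟩ := exists_isUnit_of_isUnit_sum Finset.univ
    (fun k => (b k ∘ₗ a k : Module.End R M)) (by rw [h]; exact isUnit_one)
  exact ⟨k, isSummand_of_isUnit _ _ hk⟩

/-- A finite length module is in `add X` once its indecomposable summands are. -/
theorem memAdd_of_indec {X M : ModuleCat.{0} R} [IsArtinian R M]
    (h : ∀ N : ModuleCat.{0} R, IsSummand N M → Indec R N → MemAdd X N) : MemAdd X M := by
  obtain ⟨ι, _, _, f, hf, -, hs⟩ := exists_primitive_decomposition (1 : Module.End R M)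
    (mul_one 1)
  refine memAdd_of_sum (fun i => ModuleCat.of R (LinearMap.range (f i)))
    (fun i => h _ (isSummand_range (hf i).2.1) (hf i).indec_range)
    (fun i => (f i).rangeRestrict) (fun i => (LinearMap.range (f i)).subtype) ?_
  exact hs

theorem IsMaxProjInjSummand.memAdd {P : ModuleCat.{0} R} (hP : IsMaxProjInjSummand P)
    [IsArtinianRing R] {E : ModuleCat.{0} R} (hE : ProjInj E) (hf : Module.Finite R E) :
    MemAdd P E := by
  refine memAdd_of_indec fun N hN hN' => ?_
  have hNf : Module.Finite R N := summandClosed_finite hN hf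
  have hNp := summandClosed_projInj hN hE
  refine hP.2.2 N ?_ hNp
  have := hNp.1
  obtain ⟨n, p, hp⟩ := Module.Finite.exists_fin' R N
  obtain ⟨s, hs⟩ := Module.projective_lifting_property p LinearMap.id hp
  obtain ⟨ι, _, a, b, hab⟩ := memAdd_iff_sum.1
    (show MemAdd (reg R) N from ⟨n, s, p, hs⟩)
  exact (hN'.exists_isSummand (fun _ => reg R) a b hab).choose_spec

end Summands

section Dual
variable (K : Type) [Field K] {R : Type} [Ring R] [Algebra K R]

theorem dreg_smul_apply (r : R) (φ : Dreg K R) (x : R) :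
    (show R →ₗ[K] K from r • φ) x = (show R →ₗ[K] K from φ) (x * r) :=
  rfl

variable {K} in
/-- The `R`-linear map to `D R` corresponding to a `K`-linear functional. -/
def toDreg {M : Type} [AddCommGroup M] [Module R M] [Module K M] [IsScalarTower K R M]
    (l : M →ₗ[K] K) : M →ₗ[R] Dreg K R where
  toFun m := (show R →ₗ[K] K from l ∘ₗ (LinearMap.toSpanSingleton R M m).restrictScalars K)
  map_add' m m' := LinearMap.ext fun x => by
    change l (x • (m + m')) = l (x • m) + l (x • m')
    rw [smul_add, map_add]
  map_smul' r m := LinearMap.ext fun x => by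
    change l (x • r • m) = l ((x * r) • m)
    rw [mul_smul]

theorem toDreg_apply {M : Type} [AddCommGroup M] [Module R M] [Module K M]
    [IsScalarTower K R M] (l : M →ₗ[K] K) (m : M) (x : R) :
    (show R →ₗ[K] K from toDreg l m) x = l (x • m) :=
  rfl

theorem kMod_isScalarTower (M : Type) [AddCommGroup M] [Module R M] :
    letI : Module K M := Module.compHom M (algebraMap K R)
    IsScalarTower K R M := by
  let : Module K M := Module.compHom M (algebraMap K R)
  refine ⟨fun c r m => ?_⟩
  change (c • r) • m = algebraMap K R c • r • m
  rw [Algebra.smul_def, mul_smul]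

theorem injective_dreg : Module.Injective R (Dreg K R) := by
  refine ⟨fun X Y _ _ _ _ f hf g => ?_⟩
  let : Module K X := Module.compHom X (algebraMap K R)
  let : Module K Y := Module.compHom Y (algebraMap K R)
  have : IsScalarTower K R X := kMod_isScalarTower K X
  have : IsScalarTower K R Y := kMod_isScalarTower K Y
  let l : X →ₗ[K] K :=
    { toFun := fun x => (show R →ₗ[K] K from g x) 1
      map_add' := fun x y => by rw [map_add]; rfl
      map_smul' := fun c x => by
        have : g (c • x) = algebraMap K R c • g x := map_smul g (algebraMap K R c) x
        rw [this, dreg_smul_apply, one_mul, Algebra.algebraMap_eq_smul_one, map_smul]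
        rfl }
  obtain ⟨s, hs⟩ := (f.restrictScalars K).exists_leftInverse_of_injective
    (LinearMap.ker_eq_bot.2 hf)
  refine ⟨toDreg (l ∘ₗ s), fun x => LinearMap.ext fun r => ?_⟩
  rw [toDreg_apply, ← map_smul, LinearMap.comp_apply]
  have : s (f (r • x)) = r • x := LinearMap.congr_fun hs (r • x)
  rw [this]
  change (show R →ₗ[K] K from g (r • x)) 1 = _
  rw [map_smul, dreg_smul_apply, one_mul]

theorem finite_dreg [FiniteDimensional K R] : Module.Finite R (Dreg K R) := by
  let : Module K (Dreg K R) := inferInstanceAs (Module K (R →ₗ[K] K))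
  have : Module.Finite K (Dreg K R) := inferInstanceAs (Module.Finite K (R →ₗ[K] K))
  have : IsScalarTower K R (Dreg K R) := ⟨fun c r φ => LinearMap.ext fun x => by
    change (show R →ₗ[K] K from φ) (x * (c • r)) = c • (show R →ₗ[K] K from φ) (x * r)
    rw [mul_smul_comm, map_smul]⟩
  exact Module.Finite.of_restrictScalars_finite K R (Dreg K R)

theorem exists_embedding_dreg [FiniteDimensional K R] (M : ModuleCat.{0} R)
    (hM : Module.Finite R M) :
    ∃ (n : ℕ) (e : M →ₗ[R] (Fin n → Dreg K R)), Function.Injective e := by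
  let : Module K M := Module.compHom M (algebraMap K R)
  have : IsScalarTower K R M := kMod_isScalarTower K M
  have : Module.Finite K M := Module.Finite.trans R M
  let b := Module.finBasis K M
  refine ⟨_, LinearMap.pi fun i => toDreg (b.coord i), ?_⟩
  rw [injective_iff_map_eq_zero]
  intro m hm
  refine (b.forall_coord_eq_zero_iff).1 fun i => ?_
  have h : toDreg (b.coord i) m = 0 := congrFun hm i
  have := toDreg_apply K (R := R) (b.coord i) m 1
  rw [one_smul, h] at this
  exact this.symm

theorem injective_pow_dreg (n : ℕ) : Module.Injective R (ModuleCat.of R (Fin n → Dreg K R)) :=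
  of_memAdd summandClosed_injective prodClosed_injective (injective_dreg K)
    ⟨n, IsSummand.refl _⟩

/-- A finitely generated submodule of a projective-injective module is contained in a finitely
generated projective-injective module. -/
theorem exists_finite_projInj [FiniteDimensional K R] {M Y : ModuleCat.{0} R}
    (hM : Module.Finite R M) (hY : ProjInj Y) (j : M →ₗ[R] Y) (hj : Function.Injective j) :
    ∃ (E : ModuleCat.{0} R) (i : M →ₗ[R] E), Function.Injective i ∧ ProjInj E ∧
      Module.Finite R E := by
  have : IsArtinianRing R := IsArtinianRing.of_finite K R
  obtain ⟨n, e, he⟩ := exists_embedding_dreg K M hM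
  have hQ := injective_pow_dreg K (R := R) n
  have := finite_dreg K (R := R)
  obtain ⟨u, hu⟩ := exists_extension_of_injective hQ hj e
  obtain ⟨v, hv⟩ := exists_extension_of_injective hY.2 he j
  let φ : Module.End R (Fin n → Dreg K R) := u ∘ₗ v
  have hφ : ∀ x, φ (e x) = e x := fun x => by
    have h₁ : v (e x) = j x := LinearMap.congr_fun hv x
    have h₂ : u (j x) = e x := LinearMap.congr_fun hu x
    change u (v (e x)) = e x
    rw [h₁, h₂]
  have hφN : ∀ N x, (φ ^ N) (e x) = e x := by
    intro N x
    induction N with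
    | zero => rfl
    | succ N ih => rw [pow_succ, Module.End.mul_apply, hφ, ih]
  obtain ⟨N, hN, hN1⟩ := ((LinearMap.eventually_isCompl_ker_pow_range_pow φ).and
    (Filter.eventually_ge_atTop 1)).exists
  let E : ModuleCat.{0} R := ModuleCat.of R (LinearMap.range (φ ^ N))
  have hE : IsSummand E (ModuleCat.of R (Fin n → Dreg K R)) :=
    ⟨(LinearMap.range (φ ^ N)).subtype, Submodule.projectionOnto _ _ hN.symm,
      Submodule.projectionOnto_comp_subtype hN.symm⟩
  have hEi : Module.Injective R E := summandClosed_injective hE hQ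
  have hvi : Function.Injective (v ∘ₗ (LinearMap.range (φ ^ N)).subtype) := by
    rw [injective_iff_map_eq_zero]
    rintro ⟨x, hx⟩ h
    have h₀ : φ x = 0 := by
      change u (v x) = 0
      rw [show v x = 0 from h, map_zero]
    obtain ⟨N, rfl⟩ : ∃ k, N = k + 1 := ⟨N - 1, by omega⟩
    have h₁ : x ∈ LinearMap.ker (φ ^ (N + 1)) := by
      rw [LinearMap.mem_ker, pow_succ, Module.End.mul_apply, h₀, map_zero]
    exact Subtype.ext (Submodule.disjoint_def.1 hN.disjoint x h₁ hx)
  obtain ⟨r, hr⟩ := exists_extension_of_injective hEi hvi LinearMap.id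
  refine ⟨E, e.codRestrict _ fun x => ⟨e x, hφN N x⟩, fun x y h => ?_, ⟨?_, hEi⟩, ?_⟩
  · exact he (congrArg Subtype.val h)
  · exact summandClosed_projective ⟨_, r, hr⟩ hY.1
  · exact summandClosed_finite hE (inferInstanceAs (Module.Finite R (Fin n → Dreg K R)))

/-- For a `d`-Auslander–Gorenstein algebra, the regular module has a coresolution by
`add P` with finitely generated injective cokernel. -/
theorem cog_memAdd_of_injective_of_projInj [FiniteDimensional K R] {P : ModuleCat.{0} R}
    (hP : IsMaxProjInjSummand P) :
    ∀ {k : ℕ} {M : ModuleCat.{0} R}, Module.Finite R M →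
      Cog (fun M => Module.Injective R M) (fun M => Module.Injective R M)
        (fun M => Module.Injective R M) k M →
      Cog ProjInj ProjInj allMod k M →
      Cog noMod (MemAdd P) (fun C => Module.Injective R C ∧ Module.Finite R C) k M
  | 0, _, hM, h, _ => ⟨h, hM⟩
  | k + 1, M, hM, hI, hPI => by
    have : IsArtinianRing R := IsArtinianRing.of_finite K R
    have hPI' := hPI
    obtain ⟨Y, _, j, _, hj, hY, -, -⟩ := hPI'
    obtain ⟨E, i, hi, hE, hEf⟩ := exists_finite_projInj K hM hY j hj.inj
    have hs := isSES_mkQ hi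
    refine ⟨E, ModuleCat.of R (E ⧸ LinearMap.range i), i, _, hs, hP.memAdd hE hEf,
      fun _ h => h.elim, ?_⟩
    refine cog_memAdd_of_injective_of_projInj hP
      (inferInstanceAs (Module.Finite R (E ⧸ LinearMap.range i))) ?_ ?_
    · exact hI.coker (C := ModuleCat.of R (E ⧸ LinearMap.range i)) prodClosed_injective
        (fun _ h => h) prodClosed_injective summandClosed_injective hs hE.2
        fun J hJ => exists_extension_of_injective hJ hi
    · exact hPI.coker (C := ModuleCat.of R (E ⧸ LinearMap.range i)) prodClosed_projInj
        (fun _ _ => trivial) (fun _ _ _ _ => trivial) (fun _ _ _ _ => trivial) hs hE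
        fun J hJ => exists_extension_of_injective hJ.2 hi

end Dual

section Stable
variable {R : Type} [Ring R] {P : ModuleCat.{0} R}

theorem FactorsAdd.comp_left {L M N : ModuleCat.{0} R} {f : L →ₗ[R] M} (hf : FactorsAdd P f)
    (g : M →ₗ[R] N) : FactorsAdd P (g ∘ₗ f) := by
  obtain ⟨W, u, v, hW, rfl⟩ := hf
  exact ⟨W, u, g ∘ₗ v, hW, rfl⟩

theorem FactorsAdd.comp_right {L M N : ModuleCat.{0} R} {f : M →ₗ[R] N} (hf : FactorsAdd P f)
    (g : L →ₗ[R] M) : FactorsAdd P (f ∘ₗ g) := by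
  obtain ⟨W, u, v, hW, rfl⟩ := hf
  exact ⟨W, u ∘ₗ g, v, hW, rfl⟩

theorem factorsAdd_zero (M N : ModuleCat.{0} R) : FactorsAdd P (0 : M →ₗ[R] N) :=
  ⟨P, 0, 0, memAdd_self P, LinearMap.comp_zero _⟩

theorem factorsAdd_of_memAdd {M N W : ModuleCat.{0} R} (hW : MemAdd P W) (u : M →ₗ[R] W)
    (v : W →ₗ[R] N) : FactorsAdd P (v ∘ₗ u) :=
  ⟨W, u, v, hW, rfl⟩

theorem FactorsAdd.injective_of_isUnit (hP : ProjInj P) {L : ModuleCat.{0} R}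
    {f : Module.End R L} (hf : FactorsAdd P f) (hu : IsUnit f) : Module.Injective R L := by
  obtain ⟨W, u, v, hW, rfl⟩ := hf
  exact summandClosed_injective (isSummand_of_isUnit u v hu) (hP.of_memAdd hW).2

/-- A correspondence between endomorphism rings which identifies them modulo the maps that
factor through `add P`. -/
structure StableRel (P M C : ModuleCat.{0} R) (r : Module.End R M → Module.End R C → Prop) :
    Prop where
  exists_right : ∀ f, ∃ f', r f f'
  exists_left : ∀ f', ∃ f, r f f'
  one : r 1 1
  mul : ∀ {f f' g g'}, r f f' → r g g' → r (f * g) (f' * g')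
  sub : ∀ {f f' g g'}, r f f' → r g g' → r (f - g) (f' - g')
  factors : ∀ {f f'}, r f f' → (FactorsAdd P f ↔ FactorsAdd P f')

theorem StableRel.refl (M : ModuleCat.{0} R) : StableRel P M M Eq :=
  ⟨fun f => ⟨f, rfl⟩, fun f => ⟨f, rfl⟩, rfl, by rintro _ _ _ _ rfl rfl; rfl,
    by rintro _ _ _ _ rfl rfl; rfl, by rintro _ _ rfl; rfl⟩

theorem StableRel.comp {M N C : ModuleCat.{0} R} {r : Module.End R M → Module.End R N → Prop}
    {s : Module.End R N → Module.End R C → Prop} (hr : StableRel P M N r)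
    (hs : StableRel P N C s) : StableRel P M C (fun f f'' => ∃ f', r f f' ∧ s f' f'') where
  exists_right f := by
    obtain ⟨f', h⟩ := hr.exists_right f
    obtain ⟨f'', h'⟩ := hs.exists_right f'
    exact ⟨f'', f', h, h'⟩
  exists_left f'' := by
    obtain ⟨f', h'⟩ := hs.exists_left f''
    obtain ⟨f, h⟩ := hr.exists_left f'
    exact ⟨f, f', h, h'⟩
  one := ⟨1, hr.one, hs.one⟩
  mul := by
    rintro f f'' g g'' ⟨f', h₁, h₂⟩ ⟨g', h₃, h₄⟩
    exact ⟨f' * g', hr.mul h₁ h₃, hs.mul h₂ h₄⟩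
  sub := by
    rintro f f'' g g'' ⟨f', h₁, h₂⟩ ⟨g', h₃, h₄⟩
    exact ⟨f' - g', hr.sub h₁ h₃, hs.sub h₂ h₄⟩
  factors := by
    rintro f f'' ⟨f', h₁, h₂⟩
    rw [hr.factors h₁, hs.factors h₂]

/-- The correspondence induced by a short exact sequence with middle term in `add P`. -/
theorem IsSES.stableRel (hP : ProjInj P) {M W N : ModuleCat.{0} R} (hW : MemAdd P W)
    {i : M →ₗ[R] W} {p : W →ₗ[R] N} (h : IsSES i p) :
    StableRel P M N (fun f f' => ∃ g : W →ₗ[R] W, g ∘ₗ i = i ∘ₗ f ∧ f' ∘ₗ p = p ∘ₗ g) where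
  exists_right f := by
    obtain ⟨g, hg⟩ := exists_extension_of_injective (hP.of_memAdd hW).2 h.inj (i ∘ₗ f)
    obtain ⟨f', hf'⟩ := exists_desc_of_exact h.exact h.surj (p ∘ₗ g)
      (by rw [LinearMap.comp_assoc, hg, ← LinearMap.comp_assoc, h.comp_eq_zero,
        LinearMap.zero_comp])
    exact ⟨f', g, hg, hf'⟩
  exists_left f' := by
    have := (hP.of_memAdd hW).1
    obtain ⟨g, hg⟩ := Module.projective_lifting_property p (f' ∘ₗ p) h.surj
    obtain ⟨f, hf⟩ := exists_lift_of_exact h.inj h.exact (g ∘ₗ i)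
      (by rw [← LinearMap.comp_assoc, hg, LinearMap.comp_assoc, h.comp_eq_zero,
        LinearMap.comp_zero])
    exact ⟨f, g, hf.symm, hg.symm⟩
  one := ⟨LinearMap.id, rfl, rfl⟩
  mul := by
    rintro f f' g g' ⟨u, hu, hu'⟩ ⟨v, hv, hv'⟩
    refine ⟨u ∘ₗ v, ?_, ?_⟩
    · rw [Module.End.mul_eq_comp, LinearMap.comp_assoc, hv, ← LinearMap.comp_assoc, hu,
        LinearMap.comp_assoc]
    · rw [Module.End.mul_eq_comp, LinearMap.comp_assoc, hv', ← LinearMap.comp_assoc, hu',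
        LinearMap.comp_assoc]
  sub := by
    rintro f f' g g' ⟨u, hu, hu'⟩ ⟨v, hv, hv'⟩
    exact ⟨u - v, by rw [LinearMap.sub_comp, LinearMap.comp_sub, hu, hv],
      by rw [LinearMap.sub_comp, LinearMap.comp_sub, hu', hv']⟩
  factors := by
    rintro f f' ⟨g, hg, hg'⟩
    constructor
    · rintro ⟨W₁, u, v, hW₁, rfl⟩
      obtain ⟨u', rfl⟩ := exists_extension_of_injective (hP.of_memAdd hW₁).2 h.inj u
      obtain ⟨s, hs⟩ := exists_desc_of_exact h.exact h.surj (g - i ∘ₗ v ∘ₗ u')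
        (by rw [LinearMap.sub_comp, hg]; exact sub_self _)
      refine ⟨W, s, p, hW, comp_eq_comp_of_surjective h.surj ?_⟩
      rw [LinearMap.comp_assoc, hs, hg', LinearMap.comp_sub, ← LinearMap.comp_assoc _ i p,
        h.comp_eq_zero, LinearMap.zero_comp, sub_zero]
    · rintro ⟨W₁, u, v, hW₁, rfl⟩
      have := (hP.of_memAdd hW₁).1
      obtain ⟨v', rfl⟩ := Module.projective_lifting_property p v h.surj
      obtain ⟨s, hs⟩ := exists_lift_of_exact h.inj h.exact (g - v' ∘ₗ u ∘ₗ p)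
        (by rw [LinearMap.comp_sub, ← hg']; exact sub_self _)
      refine ⟨W, i, s, hW, (LinearMap.cancel_left h.inj).1 ?_⟩
      rw [← LinearMap.comp_assoc, hs, ← hg, LinearMap.sub_comp, LinearMap.comp_assoc,
        LinearMap.comp_assoc, h.comp_eq_zero, LinearMap.comp_zero, LinearMap.comp_zero, sub_zero]

theorem Cog.exists_stableRel (hP : ProjInj P) {A : ModuleCat.{0} R → Prop}
    {C : ModuleCat.{0} R} :
    ∀ {k : ℕ} {M : ModuleCat.{0} R}, Cog A (MemAdd P) (fun Y => Y = C) k M →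
      ∃ r, StableRel P M C r
  | 0, M, h => by
    obtain rfl : M = C := h
    exact ⟨_, .refl M⟩
  | _ + 1, _, ⟨W, N, i, p, h, hW, _, hN⟩ => by
    obtain ⟨s, hs⟩ := hN.exists_stableRel hP
    exact ⟨_, (h.stableRel hP hW).comp hs⟩

variable {M C : ModuleCat.{0} R} {r : Module.End R M → Module.End R C → Prop}

theorem StableRel.zero (hr : StableRel P M C r) : r 0 0 := by
  simpa using hr.sub hr.one hr.one

theorem StableRel.sum (hr : StableRel P M C r) {κ : Type} (s : Finset κ)
    {f : κ → Module.End R M} {f' : κ → Module.End R C} (h : ∀ k, r (f k) (f' k)) :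
    r (∑ k ∈ s, f k) (∑ k ∈ s, f' k) := by
  classical
  induction s using Finset.induction_on with
  | empty => simpa using hr.zero
  | insert a s ha ih =>
    rw [Finset.sum_insert ha, Finset.sum_insert ha]
    simpa using hr.sub (h a) (hr.sub hr.zero ih)

theorem StableRel.factors_sub (hr : StableRel P M C r) {f g : Module.End R M}
    {f' : Module.End R C} (hf : r f f') (hg : r g f') : FactorsAdd P (f - g) := by
  have := hr.sub hf hg
  rw [sub_self] at this
  exact (hr.factors this).2 (factorsAdd_zero C C)

/-- If `L` is not injective, a unit of `End L` minus a map factoring through `add P` is a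
unit. -/
theorem isUnit_of_factorsAdd_sub (hP : ProjInj P) {L : ModuleCat.{0} R}
    [IsArtinian R L] [IsNoetherian R L] (hL : Indec R L) (hLi : ¬ Module.Injective R L)
    {u v : Module.End R L} (hu : IsUnit u) (h : FactorsAdd P (u - v)) : IsUnit v := by
  have := hL.isLocalRing
  obtain ⟨w, rfl⟩ := hu
  have h1 : (↑w⁻¹ * v : Module.End R L) + ↑w⁻¹ * (↑w - v) = 1 := by
    rw [← mul_add, add_sub_cancel, Units.inv_mul]
  rcases IsLocalRing.isUnit_or_isUnit_of_add_one h1 with h2 | h2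
  · simpa using h2
  · rw [Units.isUnit_units_mul] at h2
    exact (hLi (h.injective_of_isUnit hP h2)).elim

/-- If a stable endomorphism factoring through the indecomposable module `I` is nonzero at the
non-injective module `L`, then the idempotent of `L` becomes invertible on `I`. -/
theorem StableRel.exists_isUnit (hP : ProjInj P) (hr : StableRel P M C r)
    {L I : ModuleCat.{0} R} [IsArtinian R I] [IsNoetherian R I] (hI : Indec R I)
    (hLi : ¬ Module.Injective R L) (ι : L →ₗ[R] M) (π : M →ₗ[R] L) (a : C →ₗ[R] I)
    (b : I →ₗ[R] C) {f : Module.End R M} (hf : r f (b ∘ₗ a))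
    (hu : IsUnit (π ∘ₗ f ∘ₗ ι : Module.End R L)) :
    ∃ e, r (ι ∘ₗ π) e ∧ IsUnit (a ∘ₗ e ∘ₗ b : Module.End R I) := by
  obtain ⟨e, he⟩ := hr.exists_right (ι ∘ₗ π)
  refine ⟨e, he, (hI.isUnit_or_isNilpotent _).resolve_right ?_⟩
  rintro ⟨n, hn⟩
  have key : ∀ n : ℕ, ∃ g : Module.End R M,
      r g (b ∘ₗ ((a ∘ₗ e ∘ₗ b : Module.End R I) ^ n : Module.End R I) ∘ₗ a) ∧
      IsUnit (π ∘ₗ g ∘ₗ ι : Module.End R L) := by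
    intro n
    induction n with
    | zero => exact ⟨f, hf, hu⟩
    | succ n ih =>
      obtain ⟨g, hg, hgu⟩ := ih
      refine ⟨g * (ι ∘ₗ π) * f, ?_, ?_⟩
      · rw [pow_succ]
        exact hr.mul (hr.mul hg he) hf
      · exact hgu.mul hu
  obtain ⟨g, hg, hgu⟩ := key n
  rw [hn] at hg
  have h0 : FactorsAdd P g := by
    refine (hr.factors hg).2 ?_
    rw [LinearMap.zero_comp, LinearMap.comp_zero]
    exact factorsAdd_zero C C
  exact hLi (((h0.comp_right ι).comp_left π).injective_of_isUnit hP hgu)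

end Stable

theorem Indec.isSummand_symm {R : Type} [Ring R] {L N : ModuleCat.{0} R} (hN : Indec R N)
    (hL : Nontrivial L) (h : IsSummand L N) : IsSummand N L := by
  obtain ⟨i, p, hp⟩ := h
  have hp' : ∀ x, p (i x) = x := LinearMap.congr_fun hp
  rcases hN.2 (i ∘ₗ p) (by ext x; simp [hp']) with h | h
  · exfalso
    obtain ⟨x, hx⟩ := exists_ne (0 : L)
    refine hx ?_
    have : i (p (i x)) = 0 := LinearMap.congr_fun h (i x)
    rw [← hp' x, ← hp' (p (i x)), this, map_zero]
  · exact ⟨p, i, h⟩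

section EndDual
variable (K : Type) [Field K] {R : Type} [Ring R] [Algebra K R]

theorem end_apply {R : Type} [Ring R] (f : R →ₗ[R] R) (x : R) : f x = x * f 1 := by
  rw [← smul_eq_mul, ← map_smul, smul_eq_mul, mul_one]

/-- Left multiplication by `a` on the right module `R` induces an endomorphism of `D R`. -/
def dregEnd (a : R) : Module.End R (Dreg K R) where
  toFun φ := (show R →ₗ[K] K from (show R →ₗ[K] K from φ) ∘ₗ LinearMap.mulLeft K a)
  map_add' _ _ := rfl
  map_smul' r φ := LinearMap.ext fun x => by
    change (show R →ₗ[K] K from φ) (a * x * r) = (show R →ₗ[K] K from φ) (a * (x * r))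
    rw [mul_assoc]

variable (R) in
/-- The functor `D Hom(-, R)` on endomorphisms of the regular module. -/
def endRegHom : Module.End R (reg R) →+* Module.End R (Dreg K R) where
  toFun f := dregEnd K (show R from f (1 : R))
  map_one' := LinearMap.ext fun φ => LinearMap.ext fun x =>
    congrArg (show R →ₗ[K] K from φ) (one_mul x)
  map_mul' f g := LinearMap.ext fun φ => LinearMap.ext fun x => by
    change (show R →ₗ[K] K from φ) ((show R from f (g (1 : R))) * x) =
      (show R →ₗ[K] K from φ) ((show R from g (1 : R)) * ((show R from f (1 : R)) * x))
    rw [← mul_assoc]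
    exact congrArg (fun y : R => (show R →ₗ[K] K from φ) (y * x)) (end_apply f (g (1 : R)))
  map_zero' := LinearMap.ext fun φ => LinearMap.ext fun x => by
    change (show R →ₗ[K] K from φ) ((0 : R) * x) = 0
    rw [zero_mul, map_zero]
  map_add' f g := LinearMap.ext fun φ => LinearMap.ext fun x => by
    change (show R →ₗ[K] K from φ) (((show R from f (1 : R)) + (show R from g (1 : R))) * x) =
      (show R →ₗ[K] K from φ) ((show R from f (1 : R)) * x) +
        (show R →ₗ[K] K from φ) ((show R from g (1 : R)) * x)
    rw [add_mul, map_add]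

theorem dregEnd_surjective [FiniteDimensional K R] (h : Module.End R (Dreg K R)) :
    ∃ a : R, dregEnd K a = h := by
  let ev : Module.Dual K (Module.Dual K R) :=
    { toFun := fun φ => (show R →ₗ[K] K from h φ) 1
      map_add' := fun φ ψ => by
        have : h (φ + ψ) = h φ + h ψ := map_add h φ ψ
        rw [this]
        rfl
      map_smul' := fun c φ => by
        have h₁ : (c • φ : R →ₗ[K] K) = algebraMap K R c • (show Dreg K R from φ) :=
          LinearMap.ext fun x => by
            rw [dreg_smul_apply, ← Algebra.commutes, ← Algebra.smul_def, map_smul]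
            rfl
        have h₂ : h (c • φ : R →ₗ[K] K) = algebraMap K R c • h φ := by
          rw [h₁, map_smul]
        rw [h₂, dreg_smul_apply, one_mul, Algebra.algebraMap_eq_smul_one, map_smul]
        rfl }
  obtain ⟨a, ha⟩ := (Module.evalEquiv K R).surjective ev
  refine ⟨a, LinearMap.ext fun φ => LinearMap.ext fun x => ?_⟩
  have key : (show R →ₗ[K] K from x • φ) a = (show R →ₗ[K] K from h (x • φ)) 1 :=
    LinearMap.congr_fun ha (x • φ)
  rw [map_smul, dreg_smul_apply, dreg_smul_apply, one_mul] at key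
  exact key

variable (R) in
/-- The endomorphism rings of `R` and `D R` agree. -/
noncomputable def endRegEquiv [FiniteDimensional K R] :
    Module.End R (reg R) ≃+* Module.End R (Dreg K R) :=
  RingEquiv.ofBijective (endRegHom K R) <| by
    constructor
    · rw [injective_iff_map_eq_zero]
      intro f hf
      have h₁ : (show R from f (1 : R)) = 0 := by
        refine (Module.forall_dual_apply_eq_zero_iff K _).1 fun φ => ?_
        have : (show R →ₗ[K] K from endRegHom K R f φ) 1 = 0 := by
          rw [hf]
          rfl
        rw [← this]
        exact congrArg φ (mul_one _).symm
      refine LinearMap.ext fun x => (end_apply f x).trans ?_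
      exact (congrArg (fun y : R => (show R from x) * y) h₁).trans (mul_zero _)
    · intro h
      obtain ⟨a, rfl⟩ := dregEnd_surjective K h
      refine ⟨LinearMap.toSpanSingleton R R a, ?_⟩
      change dregEnd K ((1 : R) • a) = _
      rw [one_smul]

end EndDual

section Counting
variable {R : Type} [Ring R]

/-- The summand `L` of `M` corresponds to the indecomposable injective `I`: either `L` is an
injective summand of `I`, or some stable endomorphism through `I` is invertible on `L`. -/
def Corresponds {M C : ModuleCat.{0} R} (r : Module.End R M → Module.End R C → Prop)
    {L : ModuleCat.{0} R} (ι : L →ₗ[R] M) (π : M →ₗ[R] L) (I : ModuleCat.{0} R) : Prop :=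
  (Module.Injective R L ∧ IsSummand L I) ∨
    (¬ Module.Injective R L ∧ ∃ (a : C →ₗ[R] I) (b : I →ₗ[R] C) (f : Module.End R M),
      r f (b ∘ₗ a) ∧ IsUnit (π ∘ₗ f ∘ₗ ι : Module.End R L))

/-- A decomposition of `D R` refines to one of any finitely generated injective module. -/
theorem exists_sum_of_injective (K : Type) [Field K] [Algebra K R] [FiniteDimensional K R]
    {κ : Type} [Fintype κ] {I : κ → ModuleCat.{0} R} (u : ∀ j, Dreg K R →ₗ[R] I j)
    (v : ∀ j, I j →ₗ[R] Dreg K R) (h : ∑ j, v j ∘ₗ u j = LinearMap.id) (X : ModuleCat.{0} R)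
    (hX : Module.Injective R X) (hf : Module.Finite R X) :
    ∃ (σ : Type) (_ : Fintype σ) (c : σ → κ) (a : ∀ s, X →ₗ[R] I (c s))
      (b : ∀ s, I (c s) →ₗ[R] X), ∑ s, b s ∘ₗ a s = LinearMap.id := by
  obtain ⟨n, e, he⟩ := exists_embedding_dreg K X hf
  obtain ⟨q, hq⟩ := exists_extension_of_injective hX he LinearMap.id
  obtain ⟨τ, _, a, b, hab⟩ := memAdd_iff_sum.1 (show MemAdd (Dreg K R) X from ⟨n, e, q, hq⟩)
  refine ⟨τ × κ, inferInstance, Prod.snd, fun s => u s.2 ∘ₗ a s.1, fun s => b s.1 ∘ₗ v s.2, ?_⟩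
  rw [Fintype.sum_prod_type, ← hab]
  refine Finset.sum_congr rfl fun t _ => LinearMap.ext fun x => ?_
  have := LinearMap.congr_fun h (a t x)
  rw [LinearMap.sum_apply] at this
  rw [LinearMap.sum_apply, LinearMap.comp_apply, ← LinearMap.id_apply (R := R) (a t x), ← this,
    map_sum]
  rfl

variable {P M C : ModuleCat.{0} R} {r : Module.End R M → Module.End R C → Prop}

theorem StableRel.exists_corresponds (K : Type) [Field K] [Algebra K R] [FiniteDimensional K R]
    (hP : ProjInj P) (hr : StableRel P M C r) (hC : Module.Injective R C)
    (hCf : Module.Finite R C) {κ : Type} [Fintype κ] {I : κ → ModuleCat.{0} R}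
    (u : ∀ j, Dreg K R →ₗ[R] I j) (v : ∀ j, I j →ₗ[R] Dreg K R)
    (h : ∑ j, v j ∘ₗ u j = LinearMap.id) {L : ModuleCat.{0} R} (hL : Indec R L)
    (hLf : Module.Finite R L) {ι : L →ₗ[R] M} {π : M →ₗ[R] L} (hπ : π ∘ₗ ι = LinearMap.id) :
    ∃ j, Corresponds r ι π (I j) := by
  have : IsArtinianRing R := IsArtinianRing.of_finite K R
  by_cases hLi : Module.Injective R L
  · obtain ⟨σ, _, c, a, b, hab⟩ := exists_sum_of_injective K u v h L hLi hLf
    obtain ⟨s, hs⟩ := hL.exists_isSummand (fun s => I (c s)) a b hab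
    exact ⟨c s, Or.inl ⟨hLi, hs⟩⟩
  · obtain ⟨σ, _, c, a, b, hab⟩ := exists_sum_of_injective K u v h C hC hCf
    choose f hf using fun s => hr.exists_left (b s ∘ₗ a s)
    have hsum := hr.sum Finset.univ hf
    have h1 : FactorsAdd P (1 - ∑ s, f s : Module.End R M) :=
      hr.factors_sub (f' := LinearMap.id) hr.one (by rwa [hab] at hsum)
    have h2 : FactorsAdd P ((1 : Module.End R L) - ∑ s, (π ∘ₗ f s ∘ₗ ι : Module.End R L)) := by
      convert (h1.comp_right ι).comp_left π using 1
      ext x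
      simp only [LinearMap.sub_apply, LinearMap.sum_apply, LinearMap.comp_apply, map_sub, map_sum,
        Module.End.one_apply]
      rw [show π (ι x) = x from LinearMap.congr_fun hπ x]
    have := hL.isLocalRing
    obtain ⟨s, -, hs⟩ := exists_isUnit_of_isUnit_sum _ _
      (isUnit_of_factorsAdd_sub hP hL hLi isUnit_one h2)
    exact ⟨c s, Or.inr ⟨hLi, a s, b s, f s, hf s, hs⟩⟩

theorem memAdd_of_isSummand_injective (hP : IsMaxProjInjSummand P)
    {L I : ModuleCat.{0} R} (hL : Indec R L) (hLr : IsSummand L (reg R))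
    (hLi : Module.Injective R L) (hI : Indec R I) (h : IsSummand L I) : MemAdd P I :=
  summandClosed_memAdd P (hI.isSummand_symm hL.1 h) (hP.2.2 L hLr
    ⟨summandClosed_projective hLr (inferInstance : Module.Projective R R), hLi⟩)

theorem StableRel.not_memAdd (hP : ProjInj P) (hr : StableRel P M C r) {L I : ModuleCat.{0} R}
    {ι : L →ₗ[R] M} {π : M →ₗ[R] L} (hLi : ¬ Module.Injective R L) {a : C →ₗ[R] I}
    {b : I →ₗ[R] C} {f : Module.End R M} (hf : r f (b ∘ₗ a))
    (hu : IsUnit (π ∘ₗ f ∘ₗ ι : Module.End R L)) : ¬ MemAdd P I := fun hI =>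
  hLi (((((hr.factors hf).2 (factorsAdd_of_memAdd hI a b)).comp_right ι).comp_left
    π).injective_of_isUnit hP hu)

theorem StableRel.isSummand_of_corresponds [IsArtinianRing R] (hP : IsMaxProjInjSummand P)
    (hr : StableRel P M C r) {I : ModuleCat.{0} R} (hI : Indec R I) (hIf : Module.Finite R I)
    {L L' : ModuleCat.{0} R} (hL : Indec R L) (hLr : IsSummand L (reg R)) (hL' : Indec R L')
    (hLr' : IsSummand L' (reg R)) {ι : L →ₗ[R] M} {π : M →ₗ[R] L} {ι' : L' →ₗ[R] M}
    {π' : M →ₗ[R] L'} (h : Corresponds r ι π I) (h' : Corresponds r ι' π' I) :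
    IsSummand L' L := by
  have hLf' : Module.Finite R L' :=
    summandClosed_finite hLr' (inferInstance : Module.Finite R R)
  rcases h with ⟨hi, hs⟩ | ⟨hi, a, b, f, hf, hu⟩ <;>
    rcases h' with ⟨hi', hs'⟩ | ⟨hi', a', b', f', hf', hu'⟩
  · exact hs'.trans (hI.isSummand_symm hL.1 hs)
  · exact (hr.not_memAdd hP.2.1 hi' hf' hu'
      (memAdd_of_isSummand_injective hP hL hLr hi hI hs)).elim
  · exact (hr.not_memAdd hP.2.1 hi hf hu
      (memAdd_of_isSummand_injective hP hL' hLr' hi' hI hs')).elim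
  · obtain ⟨e, he, w, hw⟩ := hr.exists_isUnit hP.2.1 hI hi ι π a b hf hu
    obtain ⟨X, hX⟩ := hr.exists_left (b' ∘ₗ (↑w⁻¹ : Module.End R I) ∘ₗ a)
    obtain ⟨Y, hY⟩ := hr.exists_left (b ∘ₗ a')
    have key : r (X * (ι ∘ₗ π) * Y) (b' ∘ₗ a') := by
      convert hr.mul (hr.mul hX he) hY using 1
      have : b' ∘ₗ a' = b' ∘ₗ ((↑w⁻¹ : Module.End R I) * (w : Module.End R I)) ∘ₗ a' := by
        rw [Units.inv_mul]
        rfl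
      rw [this, hw]
      rfl
    have h1 := ((hr.factors_sub hf' key).comp_right ι').comp_left π'
    rw [LinearMap.sub_comp, LinearMap.comp_sub] at h1
    exact isSummand_of_isUnit (π ∘ₗ Y ∘ₗ ι') (π' ∘ₗ X ∘ₗ ι)
      (isUnit_of_factorsAdd_sub hP.2.1 hL' hi' hu' h1)

theorem StableRel.memAdd_of_corresponds [IsArtinianRing R] (hP : IsMaxProjInjSummand P)
    (hr : StableRel P M C r) {I : ModuleCat.{0} R} (hI : Indec R I) (hIf : Module.Finite R I)
    {L : ModuleCat.{0} R} (hL : Indec R L) (hLr : IsSummand L (reg R)) {ι : L →ₗ[R] M}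
    {π : M →ₗ[R] L} (h : Corresponds r ι π I) : MemAdd (ModuleCat.of R (C × P)) I := by
  rcases h with ⟨hi, hs⟩ | ⟨hi, a, b, f, hf, hu⟩
  · exact (memAdd_of_isSummand_injective hP hL hLr hi hI hs).trans
      (isSummand_prod_right C P).memAdd
  · obtain ⟨e, he, hw⟩ := hr.exists_isUnit hP.2.1 hI hi ι π a b hf hu
    exact ((isSummand_of_isUnit (e ∘ₗ b) a hw).trans (isSummand_prod_left C P)).memAdd

theorem IsBasic.eq_of_isSummand {κ : Type} {f : κ → Module.End R M} (hM : IsBasic M)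
    (hf : ∀ i, IsPrimitiveIdem (f i)) (ho : ∀ i j, i ≠ j → f i * f j = 0) {i j : κ}
    (h : IsSummand (ModuleCat.of R (LinearMap.range (f i)))
      (ModuleCat.of R (LinearMap.range (f j)))) : i = j := by
  by_contra hij
  obtain ⟨s, q, hq⟩ := h
  have hnt := (hf i).indec_range.1
  refine not_subsingleton (LinearMap.range (f i))
    (hM (ModuleCat.of R (LinearMap.range (f i))) ⟨((LinearMap.range (f i)).subtype).coprod
      ((LinearMap.range (f j)).subtype ∘ₗ s),
      ((f i).rangeRestrict).prod (q ∘ₗ (f j).rangeRestrict), ?_⟩)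
  have hfix : ∀ (k : κ) (x : LinearMap.range (f k)), (f k).rangeRestrict x = x := fun k x =>
    Subtype.ext (apply_of_mem_range_idem (hf k).2.1 x.2)
  have hzero : ∀ (k l : κ), k ≠ l → ∀ x : LinearMap.range (f l), (f k).rangeRestrict x = 0 := by
    rintro k l hkl ⟨_, y, rfl⟩
    exact Subtype.ext (LinearMap.congr_fun (ho k l hkl) y)
  have hqs : ∀ x, q (s x) = x := LinearMap.congr_fun hq
  refine LinearMap.ext fun x => Prod.ext ?_ ?_
  · change (f i).rangeRestrict ((x.1 : M) + (s x.2 : M)) = x.1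
    rw [map_add]
    exact (congrArg₂ (· + ·) (hfix i x.1) (hzero i j hij (s x.2))).trans (add_zero _)
  · change q ((f j).rangeRestrict ((x.1 : M) + (s x.2 : M))) = x.2
    rw [map_add]
    exact (congrArg q ((congrArg₂ (· + ·) (hzero j i (Ne.symm hij) x.1)
      (hfix j (s x.2))).trans (zero_add _))).trans (hqs x.2)

/-- If the basic algebra `R` has a coresolution by projective-injectives ending in the injective
module `C`, then every injective module is in `add (C ⊕ P)`. -/
theorem memAdd_dreg (K : Type) [Field K] [Algebra K R] [FiniteDimensional K R]
    (hbasic : IsBasic (reg R)) (hP : IsMaxProjInjSummand P) (hC : Module.Injective R C)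
    (hCf : Module.Finite R C) {A : ModuleCat.{0} R → Prop} {k : ℕ}
    (h : Cog A (MemAdd P) (fun Y => Y = C) k (reg R)) :
    MemAdd (ModuleCat.of R (C × P)) (Dreg K R) := by
  have : IsArtinianRing R := IsArtinianRing.of_finite K R
  have hRA : IsArtinian R (reg R) := this
  obtain ⟨r, hr⟩ := h.exists_stableRel hP.2.1
  obtain ⟨κ, _, _, f, hf, ho, hs⟩ :=
    exists_primitive_decomposition (1 : Module.End R (reg R)) (mul_one 1)
  let L : κ → ModuleCat.{0} R := fun i => ModuleCat.of R (LinearMap.range (f i))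
  let ι : ∀ i, L i →ₗ[R] reg R := fun i => (LinearMap.range (f i)).subtype
  let π : ∀ i, reg R →ₗ[R] L i := fun i => (f i).rangeRestrict
  have hπ : ∀ i, π i ∘ₗ ι i = LinearMap.id := fun i =>
    LinearMap.ext fun y => Subtype.ext (apply_of_mem_range_idem (hf i).2.1 y.2)
  have hLr : ∀ i, IsSummand (L i) (reg R) := fun i => ⟨ι i, π i, hπ i⟩
  have hL : ∀ i, Indec R (L i) := fun i => (hf i).indec_range
  have hLf : ∀ i, Module.Finite R (L i) := fun i =>
    summandClosed_finite (hLr i) (inferInstance : Module.Finite R R)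
  let g : κ → Module.End R (Dreg K R) := fun i => endRegEquiv K R (f i)
  have hg : ∀ i, IsPrimitiveIdem (g i) := fun i => (hf i).map _
  let I : κ → ModuleCat.{0} R := fun i => ModuleCat.of R (LinearMap.range (g i))
  have hI : ∀ i, Indec R (I i) := fun i => (hg i).indec_range
  have hIf : ∀ i, Module.Finite R (I i) := fun i =>
    summandClosed_finite (isSummand_range (hg i).2.1) (finite_dreg K)
  have hsum : ∑ i, (LinearMap.range (g i)).subtype ∘ₗ (g i).rangeRestrict = LinearMap.id := by
    change ∑ i, endRegEquiv K R (f i) = 1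
    rw [← map_sum, hs, map_one]
  choose t ht using fun i => hr.exists_corresponds K hP.2.1 hC hCf (I := I)
    (fun i => (g i).rangeRestrict) (fun i => (LinearMap.range (g i)).subtype) hsum (hL i) (hLf i)
    (hπ i)
  have hinj : Function.Injective t := fun i j hij =>
    hbasic.eq_of_isSummand hf ho (hr.isSummand_of_corresponds hP (hI (t j)) (hIf (t j))
      (hL j) (hLr j) (hL i) (hLr i) (ht j) (hij ▸ ht i))
  refine memAdd_of_sum I (fun j => ?_) (fun i => (g i).rangeRestrict)
    (fun i => (LinearMap.range (g i)).subtype) hsum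
  obtain ⟨i, rfl⟩ := Finite.surjective_of_injective hinj j
  exact hr.memAdd_of_corresponds hP (hI _) (hIf _) (hL i) (hLr i) (ht i)

end Counting

section Forward
variable {R : Type} [Ring R]

theorem Cog.finite_terminal {A Q Z : ModuleCat.{0} R → Prop}
    (hQ : ∀ M, Q M → Module.Finite R M) :
    ∀ {k : ℕ} {M : ModuleCat.{0} R}, Module.Finite R M → Cog A Q Z k M →
      Cog A Q (fun X => Z X ∧ Module.Finite R X) k M
  | 0, _, hM, h => ⟨h, hM⟩
  | _ + 1, _, _, ⟨I, C, i, p, h, hI, happ, hC⟩ => by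
    have := hQ I hI
    exact ⟨I, C, i, p, h, hI, happ, hC.finite_terminal hQ (Module.Finite.of_surjective p h.surj)⟩

/-- Cokernels of coresolutions by projective-injectives are left orthogonal to modules with a
long enough resolution by projective-injectives. -/
theorem Cog.leftPerp {P T : ModuleCat.{0} R} (hP : ProjInj P) {A : ModuleCat.{0} R → Prop}
    {m : ℕ} (hT : Gen (MemAdd P) allMod m T) {C : ModuleCat.{0} R} :
    ∀ {j a : ℕ} {M : ModuleCat.{0} R}, a + j = m → GenFactors P a M → LeftPerp T M →
      Cog A (MemAdd P) (fun Y => Y = C) j M → LeftPerp T C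
  | 0, _, _, _, _, hM, h => by
    obtain rfl := h
    exact hM
  | j + 1, a, M, haj, hM, hMT, ⟨W, N, i, p, h, hW, _, hN⟩ => by
    refine hN.leftPerp hP hT (a := a + 1) (by omega) (hM.succ hP hW h)
      (leftPerp_right h.inj h.exact h.surj hMT
        (leftPerp_of_projective T (hP.of_memAdd hW).1) fun g => ?_)
    obtain ⟨V, u, v, hV, rfl⟩ := hM T (hT.of_le (by omega)) g
    obtain ⟨u', rfl⟩ := exists_extension_of_injective (hP.of_memAdd hV).2 h.inj u
    exact ⟨v ∘ₗ u', rfl⟩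

theorem exists_tilting_cotilting (K : Type) [Field K] [Algebra K R] [FiniteDimensional K R]
    (hbasic : IsBasic (reg R)) {P : ModuleCat.{0} R} (hP : IsMaxProjInjSummand P) {m n : ℕ}
    (hid : IdimLE (m + n) (reg R)) (hdom : DomdimGE R (m + n)) :
    ∃ T : ModuleCat.{0} R, MemGenShift m P T ∧ MemCogenShift n P T ∧ IsTilting m T ∧
      IsCotilting K n T := by
  have hR : Module.Projective R (reg R) := (inferInstance : Module.Projective R R)
  have hRf : Module.Finite R (reg R) := (inferInstance : Module.Finite R R)
  have hPf : Module.Finite R P := summandClosed_finite hP.1 hRf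
  have hcog := cog_memAdd_of_injective_of_projInj K hP hRf
    (hid.cog.approx_of_injective fun _ h => h) (hdom.cog.approx_of_injective fun _ h => h.2)
  have hcog' := (cog_split hcog).finite_terminal
    (fun M hM => of_memAdd summandClosed_finite prodClosed_finite hPf hM) hRf
  obtain ⟨C, ⟨hCn, hCf⟩, hCm⟩ := hcog'.exists_terminal
  let T : ModuleCat.{0} R := ModuleCat.of R (C × P)
  have hCT : MemAdd T C := (isSummand_prod_left C P).memAdd
  have hPT : MemAdd T P := (isSummand_prod_right C P).memAdd
  have hTf : Module.Finite R T := prodClosed_finite hCf hPf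
  have hTm : Cog noMod (MemAdd P) (fun Y => Y = T) m (ModuleCat.of R (reg R × P)) :=
    hCm.prod (prodClosed_memAdd P) (Z' := fun Y => Y = P) (by rintro _ _ rfl rfl; rfl)
      (cog_self (prodClosed_memAdd P) (memAdd_self P) m)
  have hTn : Cog noMod (MemAdd P) (fun X => Module.Injective R X) n T :=
    Cog.prod_mem (prodClosed_memAdd P) (fun M hM => (hP.2.1.of_memAdd hM).2) prodClosed_injective
      (hCn.mono (fun _ h => h) (fun _ h => h) fun _ h => h.1) (memAdd_self P)
  have hgen := hTm.memGenShift
  have hext : ExtVanishing T T := by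
    rw [extVanishing_iff_leftPerp]
    refine prodClosed_leftPerp T ?_ (leftPerp_of_projective T hP.2.1.1)
    exact hCm.leftPerp hP.2.1 hgen.gen (Nat.zero_add m) (genFactors_zero P hR)
      (leftPerp_of_projective T hR)
  refine ⟨T, hgen, hTn.memCogenShift, ⟨hTf, ?_, hext, ?_⟩, hTf, ?_, hext, ?_⟩
  · exact Cog.pdimLE (prodClosed_projective hR hP.2.1.1)
      (hTm.mono (fun _ h => h) (fun M hM => (hP.2.1.of_memAdd hM).1) fun _ h => h)
  · obtain ⟨Y, f, h₁, h₂, h₃, h₄⟩ := hCm.exists_isExactSeq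
    refine ⟨Y, f, h₁, h₂, fun i hi hi' => ?_⟩
    obtain rfl | hk := eq_or_lt_of_le hi'
    · exact h₄ ▸ hCT
    · exact (h₃ i hi (by omega)).trans hPT
  · exact (hTn.mono (fun _ h => h) (fun M hM => (hP.2.1.of_memAdd hM).2) fun _ h => h).idimLE
  · obtain ⟨X, ⟨hXi, hXf⟩, hCX⟩ := hCn.exists_terminal
    have hRX : Cog noMod (MemAdd P) (fun Y => Y = X) (m + n) (reg R) :=
      cog_append (hCm.mono (fun _ h => h) (fun _ h => h) (by rintro _ rfl; exact hCX))
    have hadd := memAdd_dreg K hbasic hP hXi hXf hRX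
    have hPZ : ∀ M, MemAdd P M → MemAdd T M := fun M hM => hM.trans hPT
    have hXgen : Gen (MemAdd P) (MemAdd T) n X := by
      obtain ⟨_, rfl, h⟩ := Gen.exists_of_cog (j := 0) (Q := MemAdd P) (Z := MemAdd T) hCT hCX
      rwa [Nat.zero_add] at h
    have hprod := Gen.prod (prodClosed_memAdd P) (prodClosed_memAdd T) n
    have hD : Gen (MemAdd P) (MemAdd T) n (Dreg K R) :=
      of_memAdd (summandClosed_gen (prodClosed_memAdd P) (fun M hM => (hP.2.1.of_memAdd hM).1)
        hPZ (prodClosed_memAdd T) (summandClosed_memAdd T) n) hprod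
        (hprod hXgen (gen_self (prodClosed_memAdd P) hPZ (memAdd_self P) n)) hadd
    obtain ⟨N, hN, hND⟩ := Cog.exists_of_gen (j := 0) (W := fun Y => Y = Dreg K R) rfl hD
    rw [Nat.zero_add] at hND
    obtain ⟨Y, f, h₁, rfl, h₃, h₄⟩ := hND.exists_isExactSeq
    refine ⟨Y, f, h₁, h₄, fun i hi => ?_⟩
    rcases i with _ | i
    · exact hN
    · exact hPZ _ (h₃ _ (by omega) hi)

end Forward

end PS

open PS in
/-- Corollary `democratic-dAG`.
An algebra `Γ` is `d`-Auslander–Gorenstein if and only if for some (equivalently, every)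
`m, n ≥ 0` with `d = m + n - 1` (i.e. `m + n = d + 1`), there is a `Γ`-module in
`gen_{m-1}(Π) ∩ cogen^{n-1}(Π)` that is simultaneously `m`-tilting and `n`-cotilting, where
`Π` is the maximal projective-injective direct summand of `Γ`. -/
theorem statement11 (K : Type) [Field K] (Γ : Type) [Ring Γ] [Algebra K Γ]
    [FiniteDimensional K Γ] (hbasic : IsBasic (reg Γ)) (d : ℕ) (hd : 1 ≤ d)
    (Pii : ModuleCat.{0} Γ) (hPii : IsMaxProjInjSummand Pii) :
    (IsAuslanderGorenstein Γ d ↔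
      (∃ m n : ℕ, m + n = d + 1 ∧
        ∃ T : ModuleCat.{0} Γ, MemGenShift m Pii T ∧ MemCogenShift n Pii T ∧
          IsTilting m T ∧ IsCotilting K n T)) ∧
    (IsAuslanderGorenstein Γ d ↔
      (∀ m n : ℕ, m + n = d + 1 →
        ∃ T : ModuleCat.{0} Γ, MemGenShift m Pii T ∧ MemCogenShift n Pii T ∧
          IsTilting m T ∧ IsCotilting K n T)) := by
  have hmp : IsAuslanderGorenstein Γ d → ∀ m n : ℕ, m + n = d + 1 →
      ∃ T : ModuleCat.{0} Γ, MemGenShift m Pii T ∧ MemCogenShift n Pii T ∧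
        IsTilting m T ∧ IsCotilting K n T := by
    rintro ⟨hid, hdom⟩ m n hmn
    rw [← hmn] at hid hdom
    exact exists_tilting_cotilting K hbasic hPii hid hdom
  have hmpr : (∃ m n : ℕ, m + n = d + 1 ∧
      ∃ T : ModuleCat.{0} Γ, MemGenShift m Pii T ∧ MemCogenShift n Pii T ∧
        IsTilting m T ∧ IsCotilting K n T) → IsAuslanderGorenstein Γ d := by
    rintro ⟨m, n, hmn, T, hg, hc, ht, hct⟩
    rw [IsAuslanderGorenstein, ← hmn]
    exact idimLE_domdimGE_of_tilting hPii hg hc ht hct.2.1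
  have h0 : 0 + (d + 1) = d + 1 := Nat.zero_add _
  exact ⟨⟨fun h => ⟨0, d + 1, h0, hmp h _ _ h0⟩, hmpr⟩,
    ⟨hmp, fun h => hmpr ⟨0, d + 1, h0, h _ _ h0⟩⟩⟩
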